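/- For n ≥ 295660, every n-vertex planar graph with more than ⌊(8n−13)/3⌋ edges contains a vertex-disjoint union of a 3-cycle and a 5-cycle as a subgraph. -/

import Mathlib

/-- `H` is a minor of `G`: branch sets are nonempty, connected, pairwise
disjoint, and adjacencies of `H` are realized between branch sets. -/
def SimpleGraph.IsMinorOf {α β : Type} (H : SimpleGraph α) (G : SimpleGraph β) : Prop :=
  ∃ φ : α → Set β,
    (∀ a, (φ a).Nonempty) ∧
    (∀ a, ((G.induce (φ a)).Connected)) ∧
    (∀ a b, a ≠ b → Disjoint (φ a) (φ b)) ∧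
    (∀ a b, H.Adj a b → ∃ x ∈ φ a, ∃ y ∈ φ b, G.Adj x y)

/-- Planarity via Wagner's theorem: no `K₅` minor and no `K₃,₃` minor. -/
def SimpleGraph.IsPlanar {β : Type} (G : SimpleGraph β) : Prop :=
  ¬ (completeGraph (Fin 5)).IsMinorOf G ∧
  ¬ (completeBipartiteGraph (Fin 3) (Fin 3)).IsMinorOf G
/-- `G` contains a vertex-disjoint union of a 3-cycle and a 5-cycle. -/
def SimpleGraph.ContainsC3C5 {V : Type} (G : SimpleGraph V) : Prop :=
  ∃ (a b : V) (c : G.Walk a a) (d : G.Walk b b),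
    c.IsCycle ∧ c.length = 3 ∧ d.IsCycle ∧ d.length = 5 ∧
    ∀ x, x ∈ c.support → x ∉ d.support


open Finset Classical in
/-- cut-style connectedness of a finite vertex set -/
def Conn {V : Type} (G : SimpleGraph V) (s : Finset V) : Prop :=
  s.Nonempty ∧ ∀ D ⊆ s, D.Nonempty → (∀ a ∈ D, ∀ b ∈ s, G.Adj a b → b ∈ D) → s ⊆ D

/-- there is an edge between two vertex sets -/
def Touch {V : Type} (G : SimpleGraph V) (A B : Finset V) : Prop :=
  ∃ a ∈ A, ∃ b ∈ B, G.Adj a b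

section Basics
open Classical
variable {V : Type} {G : SimpleGraph V}

theorem Touch.symm {A B : Finset V} (h : Touch G A B) : Touch G B A := by
  obtain ⟨a, ha, b, hb, hab⟩ := h
  exact ⟨b, hb, a, ha, hab.symm⟩

theorem Touch.mono {A B A' B' : Finset V} (h : Touch G A B) (hA : A ⊆ A') (hB : B ⊆ B') :
    Touch G A' B' := by
  obtain ⟨a, ha, b, hb, hab⟩ := h
  exact ⟨a, hA ha, b, hB hb, hab⟩

theorem Conn.induce {s : Finset V} (h : Conn G s) : (G.induce (s : Set V)).Connected := by
  rw [SimpleGraph.connected_iff]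
  obtain ⟨⟨w, hw⟩, h⟩ := h
  refine ⟨?_, ⟨⟨w, hw⟩⟩⟩
  rintro ⟨a, ha⟩ ⟨b, hb⟩
  have := h (s.filter fun w => ∃ h : w ∈ (s : Set V),
    (G.induce (s : Set V)).Reachable ⟨a, ha⟩ ⟨w, h⟩) (Finset.filter_subset _ _)
    ⟨a, by
      simp only [Finset.mem_filter]
      exact ⟨ha, ha, SimpleGraph.Reachable.refl _⟩⟩ (by
      intro c hc d hd hcd
      simp only [Finset.mem_filter] at hc ⊢
      obtain ⟨hc, hc', hr⟩ := hc
      refine ⟨hd, hd, hr.trans ?_⟩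
      apply SimpleGraph.Adj.reachable
      exact hcd)
  have hb' := this hb
  simp only [Finset.mem_filter] at hb'
  exact hb'.2.2

theorem conn_of_induce {s : Finset V} (h : (G.induce (s : Set V)).Connected) : Conn G s := by
  rw [SimpleGraph.connected_iff] at h
  obtain ⟨h, ⟨⟨w, hw⟩⟩⟩ := h
  refine ⟨⟨w, hw⟩, ?_⟩
  intro D hD ⟨d, hd⟩ hcl b hb
  obtain ⟨p⟩ := h ⟨d, hD hd⟩ ⟨b, hb⟩
  have key : ∀ (u v : (s : Set V)) (p : (G.induce (s : Set V)).Walk u v), (u : V) ∈ D → (v : V) ∈ D := by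
    intro u v p
    induction p with
    | nil => exact id
    | cons hadj _ ih =>
      intro hu
      exact ih (hcl _ hu _ (Subtype.property _) hadj)
  exact key _ _ p hd

theorem conn_singleton (a : V) : Conn G {a} := by
  refine ⟨⟨a, by simp⟩, ?_⟩
  intro D hD ⟨d, hd⟩ _ b hb
  have := hD hd
  simp at this hb
  subst this; subst hb; exact hd

theorem conn_pair {a b : V} (h : G.Adj a b) : Conn G {a, b} := by
  refine ⟨⟨a, by simp⟩, ?_⟩
  intro D hD ⟨d, hd⟩ hcl c hc
  have h1 := hD hd
  have h2 := hcl d hd c hc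
  simp at h1 hc
  rcases h1 with rfl | rfl <;> rcases hc with rfl | rfl
  · exact hd
  · exact h2 h
  · exact h2 h.symm
  · exact hd

theorem Conn.insert {s : Finset V} (h : Conn G s) {w p : V} (hp : p ∈ s) (hpw : G.Adj p w) :
    Conn G (insert w s) := by
  refine ⟨⟨w, by simp⟩, ?_⟩
  intro D hD ⟨d, hd⟩ hcl
  have hne : (D ∩ s).Nonempty := by
    have := hD hd
    simp only [Finset.mem_insert] at this
    rcases this with rfl | h
    · exact ⟨p, Finset.mem_inter.2 ⟨hcl _ hd p (by simp [hp]) hpw.symm, hp⟩⟩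
    · exact ⟨d, Finset.mem_inter.2 ⟨hd, h⟩⟩
  have h1 := h.2 (D ∩ s) Finset.inter_subset_right hne (by
    intro a ha b hb hab
    simp only [Finset.mem_inter] at ha ⊢
    exact ⟨hcl a ha.1 b (by simp [hb]) hab, hb⟩)
  have hpD : p ∈ D := (Finset.mem_inter.1 (h1 hp)).1
  intro b hb
  simp only [Finset.mem_insert] at hb
  rcases hb with rfl | hb
  · exact hcl p hpD _ (by simp) hpw
  · exact (Finset.mem_inter.1 (h1 hb)).1

/-- an edge leaving a proper nonempty subset of a connected set -/
theorem Conn.exit {s D : Finset V} (h : Conn G s) (hD : D ⊆ s) (hne : D.Nonempty) {o : V}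
    (ho : o ∈ s) (hoD : o ∉ D) : ∃ a ∈ D, ∃ b ∈ s, b ∉ D ∧ G.Adj a b := by
  by_contra hcon
  push Not at hcon
  apply hoD
  refine h.2 D hD hne ?_ ho
  intro a ha b hb hab
  by_contra hbD
  exact hcon a ha b hb hbD hab

theorem exists_comp (X : Finset V) {p : V} (hp : p ∈ X) :
    ∃ Z ⊆ X, p ∈ Z ∧ Conn G Z ∧ ∀ a ∈ Z, ∀ b ∈ X, G.Adj a b → b ∈ Z := by
  set Z := X.filter (fun z => ∀ D ⊆ X, p ∈ D → (∀ a ∈ D, ∀ b ∈ X, G.Adj a b → b ∈ D) → z ∈ D)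
    with hZ
  have hZX : Z ⊆ X := Finset.filter_subset _ _
  have hpZ : p ∈ Z := by
    rw [hZ, Finset.mem_filter]
    exact ⟨hp, fun D _ h _ => h⟩
  have hcl : ∀ a ∈ Z, ∀ b ∈ X, G.Adj a b → b ∈ Z := by
    intro a ha b hb hab
    rw [hZ, Finset.mem_filter] at ha ⊢
    exact ⟨hb, fun D hD hpD hc => hc a (ha.2 D hD hpD hc) b hb hab⟩
  have hmin : ∀ D ⊆ X, p ∈ D → (∀ a ∈ D, ∀ b ∈ X, G.Adj a b → b ∈ D) → Z ⊆ D := by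
    intro D hD hpD hc z hz
    rw [hZ, Finset.mem_filter] at hz
    exact hz.2 D hD hpD hc
  refine ⟨Z, hZX, hpZ, ⟨⟨p, hpZ⟩, ?_⟩, hcl⟩
  intro D hD ⟨d, hd⟩ hc
  by_cases hpD : p ∈ D
  · apply hmin D (hD.trans hZX) hpD
    intro a ha b hb hab
    exact hc a ha b (hcl a (hD ha) b hb hab) hab
  · exfalso
    have := hmin (Z \ D) (Finset.sdiff_subset.trans hZX) (by simp [hpZ, hpD]) (by
      intro a ha b hb hab
      simp only [Finset.mem_sdiff] at ha ⊢
      refine ⟨hcl a ha.1 b hb hab, fun hbD => ha.2 (hc b hbD a ha.1 hab.symm)⟩)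
    have h2 := this (hD hd)
    simp [hd] at h2

theorem noK5 (hP : G.IsPlanar) {A B C D E : Finset V}
    (hc : ∀ X ∈ [A, B, C, D, E], Conn G X)
    (hd : [A, B, C, D, E].Pairwise Disjoint)
    (ht : [A, B, C, D, E].Pairwise (Touch G)) : False := by
  apply hP.1
  refine ⟨fun i => ((![A, B, C, D, E] i : Finset V) : Set V), ?_, ?_, ?_, ?_⟩
  · intro i
    have : Conn G (![A, B, C, D, E] i) := by fin_cases i <;> simp_all
    exact_mod_cast this.1
  · intro i
    have : Conn G (![A, B, C, D, E] i) := by fin_cases i <;> simp_all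
    exact this.induce
  · have key : ∀ i j : Fin 5, i < j → Disjoint (![A, B, C, D, E] i) (![A, B, C, D, E] j) := by
      simp only [List.pairwise_cons, List.mem_cons] at hd
      intro i j hij
      fin_cases i <;> fin_cases j <;> simp_all <;> tauto
    intro i j hij
    rw [Finset.disjoint_coe]
    rcases lt_or_gt_of_ne hij with h | h
    · exact key i j h
    · exact (key j i h).symm
  · have key : ∀ i j : Fin 5, i < j → Touch G (![A, B, C, D, E] i) (![A, B, C, D, E] j) := by
      simp only [List.pairwise_cons, List.mem_cons] at ht
      intro i j hij
      fin_cases i <;> fin_cases j <;> simp_all <;> tauto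
    intro i j hij
    rcases lt_or_gt_of_ne hij.ne with h | h
    · exact key i j h
    · exact (key j i h).symm

theorem noK33 (hP : G.IsPlanar) {A B C D E F : Finset V}
    (hc : ∀ X ∈ [A, B, C, D, E, F], Conn G X)
    (hd : [A, B, C, D, E, F].Pairwise Disjoint)
    (ht : ∀ X ∈ [A, B, C], ∀ Y ∈ [D, E, F], Touch G X Y) : False := by
  apply hP.2
  have hm1 : ∀ i : Fin 3, ![A, B, C] i ∈ [A, B, C] := by intro i; fin_cases i <;> simp
  have hm2 : ∀ i : Fin 3, ![D, E, F] i ∈ [D, E, F] := by intro i; fin_cases i <;> simp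
  have hc1 : ∀ X ∈ [A, B, C], Conn G X := fun X hX => hc X (by simp at hX ⊢; tauto)
  have hc2 : ∀ X ∈ [D, E, F], Conn G X := fun X hX => hc X (by simp at hX ⊢; tauto)
  have hd12 : ∀ X ∈ [A, B, C], ∀ Y ∈ [D, E, F], Disjoint X Y := by
    simp only [List.pairwise_cons, List.mem_cons] at hd
    intro X hX Y hY
    simp only [List.mem_cons, List.not_mem_nil, or_false] at hX hY
    rcases hX with rfl | rfl | rfl
    · exact hd.1 Y (by tauto)
    · exact hd.2.1 Y (by tauto)
    · exact hd.2.2.1 Y (by tauto)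
  have hd1 : ∀ i j : Fin 3, i < j → Disjoint (![A, B, C] i) (![A, B, C] j) := by
    simp only [List.pairwise_cons, List.mem_cons] at hd
    intro i j hij
    fin_cases i <;> fin_cases j <;> simp_all <;> tauto
  have hd2 : ∀ i j : Fin 3, i < j → Disjoint (![D, E, F] i) (![D, E, F] j) := by
    simp only [List.pairwise_cons, List.mem_cons] at hd
    intro i j hij
    fin_cases i <;> fin_cases j <;> simp_all <;> tauto
  refine ⟨Sum.elim (fun i => ((![A, B, C] i : Finset V) : Set V))
    (fun i => ((![D, E, F] i : Finset V) : Set V)), ?_, ?_, ?_, ?_⟩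
  · rintro (i | i)
    · exact_mod_cast (hc1 _ (hm1 i)).1
    · exact_mod_cast (hc2 _ (hm2 i)).1
  · rintro (i | i)
    · exact (hc1 _ (hm1 i)).induce
    · exact (hc2 _ (hm2 i)).induce
  · rintro (i | i) (j | j) hij
    · simp only [Sum.elim_inl, Finset.disjoint_coe]
      rcases lt_or_gt_of_ne (fun h => hij (by rw [h]) : i ≠ j) with h | h
      · exact hd1 i j h
      · exact (hd1 j i h).symm
    · simp only [Sum.elim_inl, Sum.elim_inr, Finset.disjoint_coe]
      exact hd12 _ (hm1 i) _ (hm2 j)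
    · simp only [Sum.elim_inl, Sum.elim_inr, Finset.disjoint_coe]
      exact (hd12 _ (hm1 j) _ (hm2 i)).symm
    · simp only [Sum.elim_inr, Finset.disjoint_coe]
      rcases lt_or_gt_of_ne (fun h => hij (by rw [h]) : i ≠ j) with h | h
      · exact hd2 i j h
      · exact (hd2 j i h).symm
  · rintro (i | i) (j | j) hij
    · simp at hij
    · exact ht _ (hm1 i) _ (hm2 j)
    · exact (ht _ (hm1 j) _ (hm2 i)).symm
    · simp at hij

end Basics

/-- contract `y` into `x`; `y` becomes isolated -/
def contr {V : Type} (G : SimpleGraph V) (x y : V) : SimpleGraph V where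
  Adj a b := a ≠ b ∧ a ≠ y ∧ b ≠ y ∧ (G.Adj a b ∨ (a = x ∧ G.Adj y b) ∨ (b = x ∧ G.Adj y a))
  symm := ⟨by
    rintro a b ⟨h1, h2, h3, h4⟩
    refine ⟨h1.symm, h3, h2, ?_⟩
    rcases h4 with h | h | h
    · exact Or.inl h.symm
    · exact Or.inr (Or.inr h)
    · exact Or.inr (Or.inl h)⟩
  loopless := ⟨fun a h => h.1 rfl⟩

/-- restriction of a graph to a vertex set -/
def restr {V : Type} (G : SimpleGraph V) (A : Finset V) : SimpleGraph V where
  Adj a b := G.Adj a b ∧ a ∈ A ∧ b ∈ A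
  symm := ⟨fun _ _ h => ⟨h.1.symm, h.2.2, h.2.1⟩⟩
  loopless := ⟨fun _ h => h.1.ne rfl⟩

section Minors
open Classical
variable {V : Type} {G : SimpleGraph V}

theorem minor_mono {α : Type} {H : SimpleGraph α} {G' : SimpleGraph V} (hle : G' ≤ G)
    (h : H.IsMinorOf G') : H.IsMinorOf G := by
  obtain ⟨φ, h1, h2, h3, h4⟩ := h
  refine ⟨φ, h1, ?_, h3, ?_⟩
  · intro a
    refine (h2 a).mono ?_
    intro u v huv
    exact hle huv
  · intro a b hab
    obtain ⟨x, hx, y, hy, hxy⟩ := h4 a b hab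
    exact ⟨x, hx, y, hy, hle hxy⟩

theorem planar_mono {G' : SimpleGraph V} (hle : G' ≤ G) (h : G.IsPlanar) : G'.IsPlanar :=
  ⟨fun h' => h.1 (minor_mono hle h'), fun h' => h.2 (minor_mono hle h')⟩

theorem restr_le (A : Finset V) : restr G A ≤ G := fun _ _ h => h.1

theorem Conn.induce' {t : Finset V} {s : Set V} (h : Conn G t) (e : (t : Set V) = s) :
    (G.induce s).Connected := by
  subst e
  exact h.induce

theorem conn_of_induce' {t : Finset V} {s : Set V} (h : (G.induce s).Connected)
    (e : (t : Set V) = s) : Conn G t := by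
  subst e
  exact conn_of_induce h

theorem minor_contr [Fintype V] {α : Type} {H : SimpleGraph α} {x y : V} (hxy : G.Adj x y)
    (hH : ∀ a, ∃ b, H.Adj a b) (h : H.IsMinorOf (contr G x y)) : H.IsMinorOf G := by
  obtain ⟨φ, h1, h2, h3, h4⟩ := h
  have hconn : ∀ a, Conn (contr G x y) (φ a).toFinset := by
    intro a
    exact conn_of_induce' (h2 a) (by simp)
  have hy : ∀ a, y ∉ φ a := by
    intro a hya
    obtain ⟨b, hb⟩ := hH a
    obtain ⟨p, hp, q, hq, hpq⟩ := h4 a b hb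
    have := (hconn a).2 {y} (by simpa using hya) (by simp) (by
      intro c hc d hd hcd
      simp at hc
      exact absurd hc hcd.2.1)
    have h5 := this (show p ∈ (φ a).toFinset by simpa using hp)
    simp at h5
    exact hpq.2.1 h5
  refine ⟨fun a => if x ∈ φ a then insert y (φ a) else φ a, ?_, ?_, ?_, ?_⟩
  · intro a
    dsimp only
    split_ifs
    · exact ⟨y, by simp⟩
    · exact h1 a
  · intro a
    by_cases hx : x ∈ φ a
    · have : Conn G (insert y (φ a).toFinset) := by
        refine ⟨⟨y, by simp⟩, ?_⟩
        intro D hD hne hcl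
        have hxy' : x ∈ D ↔ y ∈ D :=
          ⟨fun h => hcl x h y (by simp) hxy, fun h => hcl y h x (by simp [hx]) hxy.symm⟩
        have h6 := (hconn a).2 (D.erase y) (by
          intro d hd
          have := hD (Finset.mem_of_mem_erase hd)
          simp only [Finset.mem_insert] at this
          exact this.resolve_left (Finset.ne_of_mem_erase hd)) (by
          by_cases hyD : y ∈ D
          · exact ⟨x, Finset.mem_erase.2 ⟨hxy.ne, hxy'.2 hyD⟩⟩
          · obtain ⟨d, hd⟩ := hne
            exact ⟨d, Finset.mem_erase.2 ⟨fun h => hyD (h ▸ hd), hd⟩⟩) (by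
          intro c hc d hd hcd
          rw [Finset.mem_erase] at hc ⊢
          refine ⟨hcd.2.2.1, ?_⟩
          have hd' : d ∈ insert y (φ a).toFinset := Finset.mem_insert_of_mem hd
          rcases hcd.2.2.2 with h | ⟨rfl, h⟩ | ⟨rfl, h⟩
          · exact hcl c hc.2 d hd' h
          · exact hcl y (hxy'.1 hc.2) d hd' h
          · exact hxy'.2 (hcl c hc.2 y (by simp) h.symm))
        have hxD : x ∈ D := Finset.mem_of_mem_erase (h6 (by simpa using hx))
        intro b hb
        rw [Finset.mem_insert] at hb
        rcases hb with rfl | hb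
        · exact hxy'.1 hxD
        · exact Finset.mem_of_mem_erase (h6 hb)
      exact this.induce' (by simp [hx])
    · have : Conn G (φ a).toFinset := by
        refine ⟨(hconn a).1, ?_⟩
        intro D hD hne hcl
        apply (hconn a).2 D hD hne
        intro c hc d hd hcd
        rcases hcd.2.2.2 with h | ⟨rfl, h⟩ | ⟨rfl, h⟩
        · exact hcl c hc d hd h
        · exact absurd (hD hc) (by simpa using hx)
        · exact absurd hd (by simpa using hx)
      exact this.induce' (by simp [hx])
  · intro a b hab
    have h5 := h3 a b hab
    dsimp only
    rw [Set.disjoint_left] at h5 ⊢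
    intro v hva hvb
    split_ifs at hva hvb with hxa hxb hxb
    · exact h5 hxa hxb
    · rcases hva with rfl | hva
      · exact hy b hvb
      · exact h5 hva hvb
    · rcases hvb with rfl | hvb
      · exact hy a hva
      · exact h5 hva hvb
    · exact h5 hva hvb
  · intro a b hab
    obtain ⟨p, hp, q, hq, hpq⟩ := h4 a b hab
    have hsub : ∀ a, φ a ⊆ (if x ∈ φ a then insert y (φ a) else φ a) := by
      intro a
      split_ifs
      · exact Set.subset_insert _ _
      · exact subset_rfl
    have hyin : ∀ a, x ∈ φ a → y ∈ (if x ∈ φ a then insert y (φ a) else φ a) := by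
      intro a ha
      simp [ha]
    rcases hpq.2.2.2 with h | ⟨rfl, h⟩ | ⟨rfl, h⟩
    · exact ⟨p, hsub a hp, q, hsub b hq, h⟩
    · exact ⟨y, hyin a hp, q, hsub b hq, h⟩
    · exact ⟨p, hsub a hp, y, hyin b hq, h.symm⟩

theorem planar_contr [Fintype V] {x y : V} (hxy : G.Adj x y) (h : G.IsPlanar) :
    (contr G x y).IsPlanar := by
  refine ⟨fun h' => h.1 (minor_contr hxy ?_ h'), fun h' => h.2 (minor_contr hxy ?_ h')⟩
  · intro a
    exact ⟨a + 1, by simp⟩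
  · rintro (a | a)
    · exact ⟨Sum.inr 0, by simp⟩
    · exact ⟨Sum.inl 0, by simp⟩

theorem ears_aux (hP : G.IsPlanar) {x y : V} {W A B P R : Finset V} (hxW : x ∉ W) (hyW : y ∉ W)
    (hxy : x ≠ y) (hPW : P ⊆ W) (hAP : A ⊆ P)
    (hW : W = B ∪ P ∪ R) (hBP : Disjoint B P) (hBR : Disjoint B R) (hPR : Disjoint P R)
    (cA : Conn G A) (cB : Conn G B) (cP : Conn G P) (cR : Conn G R)
    (cWA : Conn G (W \ A)) (hBRt : ¬ Touch G B R)
    (xA : Touch G {x} A) (xB : Touch G {x} B) (xR : Touch G {x} R)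
    (yA : Touch G {y} A) (yB : Touch G {y} B) (yR : Touch G {y} R) : False := by
  have hBP' := Finset.disjoint_left.1 hBP
  have hBR' := Finset.disjoint_left.1 hBR
  have hPR' := Finset.disjoint_left.1 hPR
  have key : ∃ Z ⊆ P \ A, Conn G Z ∧ (∀ a ∈ Z, ∀ b ∈ P \ A, G.Adj a b → b ∈ Z) ∧
      Touch G Z B ∧ Touch G Z R := by
    by_contra hno
    push Not at hno
    obtain ⟨r, hr⟩ := cR.1
    have hrA : r ∉ A := fun h => hPR' (hAP h) hr
    obtain ⟨a, ha, b, hb, hbD, hab⟩ := cWA.exit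
      (D := B ∪ (P \ A).filter (fun p => ∃ Z ⊆ P \ A, p ∈ Z ∧ Conn G Z ∧
        (∀ a ∈ Z, ∀ b ∈ P \ A, G.Adj a b → b ∈ Z) ∧ Touch G Z B)) (o := r)
      (by
        intro d hd
        simp only [Finset.mem_union, Finset.mem_filter, Finset.mem_sdiff] at hd ⊢
        rcases hd with hd | hd
        · refine ⟨by rw [hW]; simp [hd], fun h => hBP' hd (hAP h)⟩
        · exact ⟨hPW hd.1.1, hd.1.2⟩)
      (by
        obtain ⟨b, hb⟩ := cB.1
        exact ⟨b, by simp [hb]⟩)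
      (by rw [Finset.mem_sdiff, hW]; simp [hr, hrA])
      (by
        simp only [Finset.mem_union, Finset.mem_filter, Finset.mem_sdiff]
        rintro (h | h)
        · exact hBR' h hr
        · exact hPR' h.1.1 hr)
    rw [Finset.mem_sdiff, hW] at hb
    simp only [Finset.mem_union, Finset.mem_filter, not_or, not_and] at ha hb hbD
    obtain ⟨hb1, hb2⟩ := hb
    rcases hb1 with (hb1 | hb1) | hb1
    · exact hbD.1 hb1
    · have hbPA : b ∈ P \ A := Finset.mem_sdiff.2 ⟨hb1, hb2⟩
      rcases ha with ha | ⟨ha, Z, hZ, haZ, cZ, hcl, hZB⟩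
      · obtain ⟨Z, hZ, hbZ, cZ, hcl⟩ := exists_comp (G := G) (P \ A) hbPA
        exact hbD.2 hbPA ⟨Z, hZ, hbZ, cZ, hcl, ⟨b, hbZ, a, ha, hab.symm⟩⟩
      · exact hbD.2 hbPA ⟨Z, hZ, hcl a haZ b hbPA hab, cZ, hcl, hZB⟩
    · rcases ha with ha | ⟨ha, Z, hZ, haZ, cZ, hcl, hZB⟩
      · exact hBRt ⟨a, ha, b, hb1, hab⟩
      · exact hno Z hZ cZ hcl hZB ⟨a, haZ, b, hb1, hab⟩
  obtain ⟨Z, hZ, cZ, hcl, hZB, hZR⟩ := key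
  have hZA : Touch G Z A := by
    obtain ⟨a0, ha0⟩ := cA.1
    obtain ⟨a, ha, b, hb, hbD, hab⟩ := cP.exit (D := Z) (o := a0)
      (hZ.trans Finset.sdiff_subset) cZ.1 (hAP ha0) (fun h => (Finset.mem_sdiff.1 (hZ h)).2 ha0)
    refine ⟨a, ha, b, ?_, hab⟩
    by_contra hbA
    exact hbD (hcl a ha b (Finset.mem_sdiff.2 ⟨hb, hbA⟩) hab)
  have hsW : ∀ {s : Finset V}, s ⊆ W → ∀ {z : V}, z ∉ W → Disjoint {z} s := by
    intro s hs z hz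
    rw [Finset.disjoint_singleton_left]
    exact fun h => hz (hs h)
  have hZP : Z ⊆ P := hZ.trans Finset.sdiff_subset
  have hBW : B ⊆ W := by rw [hW]; intro b hb; simp [hb]
  have hRW : R ⊆ W := by rw [hW]; intro b hb; simp [hb]
  refine noK33 hP (A := {x}) (B := {y}) (C := Z) (D := A) (E := B) (F := R) ?_ ?_ ?_
  · simp [conn_singleton, cZ, cA, cB, cR]
  · have e1 : Disjoint Z A := by
      rw [Finset.disjoint_left]
      intro z hz
      exact (Finset.mem_sdiff.1 (hZ hz)).2
    simp only [List.pairwise_cons, List.mem_cons, List.not_mem_nil, or_false, forall_eq_or_imp,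
      forall_eq, List.Pairwise.nil, and_true, false_imp_iff, implies_true]
    refine ⟨⟨?_, hsW (hZP.trans hPW) hxW, hsW (hAP.trans hPW) hxW, hsW hBW hxW, hsW hRW hxW⟩,
      ⟨hsW (hZP.trans hPW) hyW, hsW (hAP.trans hPW) hyW, hsW hBW hyW, hsW hRW hyW⟩,
      ⟨e1, (hBP.mono_right hZP).symm, hPR.mono_left hZP⟩,
      ⟨(hBP.mono_right hAP).symm, hPR.mono_left hAP⟩, hBR⟩
    simpa using hxy
  · simp [xA, xB, xR, yA, yB, yR, hZA, hZB, hZR]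

theorem three_ears (hP : G.IsPlanar) {x y : V} {W A B C : Finset V} (hxy : G.Adj x y)
    (hxW : x ∉ W) (hyW : y ∉ W) (hA : A ⊆ W) (hB : B ⊆ W) (hC : C ⊆ W)
    (hAB : Disjoint A B) (hAC : Disjoint A C) (hBC : Disjoint B C)
    (cA : Conn G A) (cB : Conn G B) (cC : Conn G C)
    (cWA : Conn G (W \ A)) (cWB : Conn G (W \ B)) (cWC : Conn G (W \ C))
    (xA : Touch G {x} A) (xB : Touch G {x} B) (xC : Touch G {x} C)
    (yA : Touch G {y} A) (yB : Touch G {y} B) (yC : Touch G {y} C) : False := by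
  obtain ⟨⟨P, R⟩, hPR, hmax⟩ := Finset.exists_max_image
    (((W \ B).powerset ×ˢ (W \ B).powerset).filter (fun q : Finset V × Finset V =>
      A ⊆ q.1 ∧ C ⊆ q.2 ∧ Disjoint q.1 q.2 ∧ Conn G q.1 ∧ Conn G q.2))
    (fun q => q.1.card + q.2.card) ⟨(A, C), by
      simp only [Finset.mem_filter, Finset.mem_product, Finset.mem_powerset, Finset.subset_sdiff]
      exact ⟨⟨⟨hA, hAB⟩, ⟨hC, hBC.symm⟩⟩, subset_rfl, subset_rfl, hAC, cA, cC⟩⟩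
  simp only [Finset.mem_filter, Finset.mem_product, Finset.mem_powerset] at hPR hmax
  obtain ⟨⟨hPW, hRW⟩, hAP, hCR, hdis, cP, cR⟩ := hPR
  have hdis' := Finset.disjoint_left.1 hdis
  have hcover : W \ B ⊆ P ∪ R := by
    intro o ho
    by_contra hoPR
    obtain ⟨p, hp⟩ := cP.1
    obtain ⟨a, ha, w, hw, hwD, haw⟩ := cWB.exit (D := P ∪ R) (o := o)
      (Finset.union_subset hPW hRW) ⟨p, by simp [hp]⟩ ho hoPR
    rw [Finset.mem_union, not_or] at hwD
    rw [Finset.mem_union] at ha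
    rcases ha with ha | ha
    · have := hmax (insert w P, R) ⟨⟨Finset.insert_subset hw hPW, hRW⟩,
        hAP.trans (Finset.subset_insert _ _), hCR, by
          rw [Finset.disjoint_insert_left]; exact ⟨hwD.2, hdis⟩, cP.insert ha haw, cR⟩
      simp only [Finset.card_insert_of_notMem hwD.1] at this
      omega
    · have := hmax (P, insert w R) ⟨⟨hPW, Finset.insert_subset hw hRW⟩,
        hAP, hCR.trans (Finset.subset_insert _ _), by
          rw [Finset.disjoint_insert_right]; exact ⟨hwD.1, hdis⟩, cP, cR.insert ha haw⟩
      simp only [Finset.card_insert_of_notMem hwD.2] at this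
      omega
  have hPW' : P ⊆ W := hPW.trans Finset.sdiff_subset
  have hRW' : R ⊆ W := hRW.trans Finset.sdiff_subset
  have hBP : Disjoint B P := (Finset.subset_sdiff.1 hPW).2.symm
  have hBR : Disjoint B R := (Finset.subset_sdiff.1 hRW).2.symm
  have hWeq : W = B ∪ P ∪ R := by
    ext w
    simp only [Finset.mem_union]
    constructor
    · intro hw
      by_cases hwB : w ∈ B
      · simp [hwB]
      · have := hcover (Finset.mem_sdiff.2 ⟨hw, hwB⟩)
        rw [Finset.mem_union] at this
        tauto
    · rintro ((h | h) | h)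
      · exact hB h
      · exact hPW' h
      · exact hRW' h
  have hPRt : Touch G P R := by
    obtain ⟨r, hr⟩ := cR.1
    obtain ⟨a, ha, w, hw, hwD, haw⟩ := cWB.exit (D := P) (o := r) hPW cP.1 (hRW hr)
      (fun h => hdis' h hr)
    refine ⟨a, ha, w, ?_, haw⟩
    have := hcover hw
    rw [Finset.mem_union] at this
    tauto
  by_cases h1 : Touch G B R
  · by_cases h2 : Touch G B P
    · have hsW : ∀ {s : Finset V}, s ⊆ W → ∀ {z : V}, z ∉ W → Disjoint {z} s := by
        intro s hs z hz
        rw [Finset.disjoint_singleton_left]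
        exact fun h => hz (hs h)
      refine noK5 hP (A := {x}) (B := {y}) (C := B) (D := P) (E := R) ?_ ?_ ?_
      · simp [conn_singleton, cB, cP, cR]
      · simp only [List.pairwise_cons, List.mem_cons, List.not_mem_nil, or_false,
          forall_eq_or_imp, forall_eq, List.Pairwise.nil, and_true, false_imp_iff, implies_true]
        exact ⟨⟨by simpa using hxy.ne, hsW hB hxW, hsW hPW' hxW, hsW hRW' hxW⟩,
          ⟨hsW hB hyW, hsW hPW' hyW, hsW hRW' hyW⟩, ⟨hBP, hBR⟩, hdis⟩
      · simp only [List.pairwise_cons, List.mem_cons, List.not_mem_nil, or_false,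
          forall_eq_or_imp, forall_eq, List.Pairwise.nil, and_true, false_imp_iff, implies_true]
        exact ⟨⟨⟨x, by simp, y, by simp, hxy⟩, xB, xA.mono subset_rfl hAP,
          xC.mono subset_rfl hCR⟩, ⟨yB, yA.mono subset_rfl hAP, yC.mono subset_rfl hCR⟩,
          ⟨h2, h1⟩, hPRt⟩
    · refine ears_aux hP (A := C) (B := B) (P := R) (R := P) hxW hyW hxy.ne hRW' hCR ?_ hBR hBP
        hdis.symm cC cB cR cP cWC h2 xC xB (xA.mono subset_rfl hAP) yC yB
        (yA.mono subset_rfl hAP)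
      rw [hWeq]
      ext w
      simp only [Finset.mem_union]
      tauto
  · exact ears_aux hP (A := A) (B := B) (P := P) (R := R) hxW hyW hxy.ne hPW' hAP hWeq hBP hBR
        hdis cA cB cP cR cWA h1 xA xB (xC.mono subset_rfl hCR) yA yB
        (yC.mono subset_rfl hCR)

end Minors

/-- three-connectedness of `G` on the vertex set `S` -/
def TC {V : Type} [DecidableEq V] (G : SimpleGraph V) (S : Finset V) : Prop :=
  4 ≤ S.card ∧ ∀ C : Finset V, C.card ≤ 2 → Conn G (S \ C)

section Thomassen
open Classical
variable {V : Type} {G : SimpleGraph V}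

theorem conn_uncontr {x y : V} (hxy : G.Adj x y) {X : Finset V} (hx : x ∈ X)
    (h : Conn (contr G x y) X) : Conn G (insert y X) := by
  refine ⟨⟨y, by simp⟩, ?_⟩
  intro D hD hne hcl
  have hxy' : x ∈ D ↔ y ∈ D :=
    ⟨fun h => hcl x h y (by simp) hxy, fun h => hcl y h x (by simp [hx]) hxy.symm⟩
  have hXD : X.erase y ⊆ D := by
    by_cases hyX : y ∈ X
    · -- `y` is isolated in the contraction, so this case cannot occur
      have := h.2 {y} (by simpa using hyX) (by simp) (by
        intro c hc d hd hcd
        simp at hc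
        exact absurd hc hcd.2.1)
      have h5 := this hx
      simp at h5
      exact absurd h5 hxy.ne
    have h6 := h.2 (D.erase y) (by
      intro d hd
      have := hD (Finset.mem_of_mem_erase hd)
      simp only [Finset.mem_insert] at this
      exact this.resolve_left (Finset.ne_of_mem_erase hd)) (by
      by_cases hyD : y ∈ D
      · exact ⟨x, Finset.mem_erase.2 ⟨hxy.ne, hxy'.2 hyD⟩⟩
      · obtain ⟨d, hd⟩ := hne
        exact ⟨d, Finset.mem_erase.2 ⟨fun h => hyD (h ▸ hd), hd⟩⟩) (by
      intro c hc d hd hcd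
      rw [Finset.mem_erase] at hc ⊢
      refine ⟨hcd.2.2.1, ?_⟩
      have hd' : d ∈ insert y X := Finset.mem_insert_of_mem hd
      rcases hcd.2.2.2 with h7 | ⟨h8, h7⟩ | ⟨h8, h7⟩
      · exact hcl c hc.2 d hd' h7
      · subst h8
        exact hcl y (hxy'.1 hc.2) d hd' h7
      · subst h8
        exact hxy'.2 (hcl c hc.2 y (by simp) h7.symm))
    intro d hd
    exact Finset.mem_of_mem_erase (h6 (Finset.mem_of_mem_erase hd))
  have hxD : x ∈ D := hXD (Finset.mem_erase.2 ⟨hxy.ne, hx⟩)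
  intro b hb
  by_cases hby : b = y
  · subst hby
    exact hxy'.1 hxD
  · exact hXD (Finset.mem_erase.2 ⟨hby, (Finset.mem_insert.1 hb).resolve_left hby⟩)

theorem conn_uncontr' {x y : V} {X : Finset V} (hx : x ∉ X)
    (h : Conn (contr G x y) X) : Conn G X := by
  refine ⟨h.1, ?_⟩
  intro D hD hne hcl
  apply h.2 D hD hne
  intro c hc d hd hcd
  rcases hcd.2.2.2 with h | ⟨rfl, h⟩ | ⟨rfl, h⟩
  · exact hcl c hc d hd h
  · exact absurd (hD hc) hx
  · exact absurd hd hx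

theorem TC.nbr_out {S : Finset V} (h : TC G S) {v : V} (hv : v ∈ S) {C : Finset V}
    (hC : C.card ≤ 2) (hvC : v ∉ C) : ∃ w ∈ S, w ∉ C ∧ G.Adj v w := by
  have h1 : 1 < (S \ C).card := by
    have := Finset.le_card_sdiff C S
    have := h.1
    omega
  obtain ⟨o, ho, hov⟩ := Finset.exists_mem_ne h1 v
  obtain ⟨a, ha, b, hb, hbD, hab⟩ := (h.2 C hC).exit (D := {v}) (o := o)
    (by simp [hv, hvC]) (by simp) ho (by simpa using hov)
  simp at ha
  subst ha
  rw [Finset.mem_sdiff] at hb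
  exact ⟨b, hb.1, hb.2, hab⟩

theorem not_tc_contr {S : Finset V} (h : TC G S) (h5 : 5 ≤ S.card)
    {x y : V} (hxy : G.Adj x y) (hxS : x ∈ S) (hyS : y ∈ S)
    (hn : ¬ TC (contr G x y) (S.erase y)) :
    ∃ a, ∃ D ⊆ S \ {x, y, a}, D.Nonempty ∧
      (∀ p ∈ D, ∀ q ∈ S \ {x, y, a}, G.Adj p q → q ∈ D) ∧ ∃ o ∈ S \ {x, y, a}, o ∉ D := by
  have hcard : (S.erase y).card = S.card - 1 := Finset.card_erase_of_mem hyS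
  have hn2 : ∃ C : Finset V, C.card ≤ 2 ∧ ¬ Conn (contr G x y) (S.erase y \ C) := by
    by_contra hcon
    push Not at hcon
    exact hn ⟨by omega, hcon⟩
  obtain ⟨C, hC, hnc⟩ := hn2
  have hne : (S.erase y \ C).Nonempty := by
    rw [← Finset.card_pos]
    have := Finset.le_card_sdiff C (S.erase y)
    omega
  by_cases hxC : x ∈ C
  · have hD : ∃ D ⊆ S.erase y \ C, D.Nonempty ∧
        (∀ p ∈ D, ∀ q ∈ S.erase y \ C, (contr G x y).Adj p q → q ∈ D) ∧
        ∃ o ∈ S.erase y \ C, o ∉ D := by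
      by_contra hcon
      apply hnc
      refine ⟨hne, fun D hD hDne hcl => ?_⟩
      intro o ho
      by_contra hoD
      exact hcon ⟨D, hD, hDne, hcl, o, ho, hoD⟩
    obtain ⟨D, hD, hDne, hcl, o, ho, hoD⟩ := hD
    have hcl' : ∀ p ∈ D, ∀ q ∈ S.erase y \ C, G.Adj p q → q ∈ D := by
      intro p hp q hq hpq
      have hp' := hD hp
      simp only [Finset.mem_sdiff, Finset.mem_erase] at hp' hq
      exact hcl p hp q (by simp [hq]) ⟨hpq.ne, hp'.1.1, hq.1.1, Or.inl hpq⟩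
    have hCe : (C.erase x).card ≤ 1 := by
      rw [Finset.card_erase_of_mem hxC]; omega
    rcases Nat.le_one_iff_eq_zero_or_eq_one.1 hCe with h0 | h1
    · rw [Finset.card_eq_zero] at h0
      have hCx : S.erase y \ C = S \ {x, y} := by
        ext v
        have : v ∈ C ↔ v = x := by
          constructor
          · intro hv
            by_contra hvx
            have : v ∈ C.erase x := Finset.mem_erase.2 ⟨hvx, hv⟩
            rw [h0] at this
            simp at this
          · rintro rfl; exact hxC
        simp only [Finset.mem_sdiff, Finset.mem_erase, Finset.mem_insert, Finset.mem_singleton,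
          this]
        tauto
      rw [hCx] at hD ho hcl'
      exact absurd ((h.2 {x, y} Finset.card_le_two).2 D hD hDne hcl' ho) hoD
    · obtain ⟨a, ha⟩ := Finset.card_eq_one.1 h1
      have hCx : S.erase y \ C = S \ {x, y, a} := by
        ext v
        have : v ∈ C ↔ v = x ∨ v = a := by
          by_cases hvx : v = x
          · simp [hvx, hxC]
          · have : v ∈ C.erase x ↔ v = a := by rw [ha]; simp
            rw [Finset.mem_erase] at this
            tauto
        simp only [Finset.mem_sdiff, Finset.mem_erase, Finset.mem_insert, Finset.mem_singleton,
          this]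
        tauto
      rw [hCx] at hD ho hcl'
      exact ⟨a, D, hD, hDne, hcl', o, ho, hoD⟩
  · exfalso
    apply hnc
    have hconn := h.2 (C.erase y) ((Finset.card_le_card (Finset.erase_subset _ _)).trans hC)
    refine ⟨hne, fun D hD hDne hcl => ?_⟩
    intro o ho
    by_contra hoD
    have ho' := ho
    simp only [Finset.mem_sdiff, Finset.mem_erase] at ho'
    have hyD : y ∉ D := fun h => by
      have := hD h
      simp at this
    have hclx : ∀ p ∈ D, ∀ q ∈ S, q ≠ y → q ∉ C → p ≠ q →
        (G.Adj p q ∨ (p = x ∧ G.Adj y q) ∨ (q = x ∧ G.Adj y p)) → q ∈ D := by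
      intro p hp q hq hqy hqC hpq hor
      exact hcl p hp q (by simp [hq, hqy, hqC]) ⟨hpq, fun h => hyD (h ▸ hp), hqy, hor⟩
    obtain ⟨a, ha, b, hb, hbD, hab⟩ := hconn.exit (D := if x ∈ D then insert y D else D) (o := o)
      (by
        intro d hd
        have : d = y ∨ d ∈ D := by
          split_ifs at hd with hx
          · simpa using hd
          · exact Or.inr hd
        rcases this with rfl | hdD
        · simp [hyS]
        · have := hD hdD
          simp only [Finset.mem_sdiff, Finset.mem_erase] at this ⊢
          tauto)
      (by
        obtain ⟨d, hd⟩ := hDne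
        refine ⟨d, ?_⟩
        split_ifs
        · simp [hd]
        · exact hd)
      (by simp only [Finset.mem_sdiff, Finset.mem_erase]; tauto)
      (by
        split_ifs
        · simp only [Finset.mem_insert]; tauto
        · exact hoD)
    simp only [Finset.mem_sdiff, Finset.mem_erase] at hb
    obtain ⟨hbS, hbC⟩ := hb
    by_cases hx : x ∈ D
    · simp only [hx, if_true, Finset.mem_insert, not_or] at ha hbD
      have hbC' : b ∉ C := fun h => hbC ⟨hbD.1, h⟩
      rcases ha with rfl | ha
      · by_cases hbx : x = b
        · exact hbD.2 (hbx ▸ hx)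
        · exact hbD.2 (hclx x hx b hbS hbD.1 hbC' hbx (Or.inr (Or.inl ⟨rfl, hab⟩)))
      · exact hbD.2 (hclx a ha b hbS hbD.1 hbC' hab.ne (Or.inl hab))
    · simp only [hx, if_false] at ha hbD
      by_cases hby : b = y
      · subst hby
        exact hx (hclx a ha x hxS hxy.ne hxC (by rintro rfl; exact hx ha)
          (Or.inr (Or.inr ⟨rfl, hab.symm⟩)))
      · have hbC' : b ∉ C := fun h => hbC ⟨hby, h⟩
        exact hbD (hclx a ha b hbS hby hbC' hab.ne (Or.inl hab))

theorem thomassen {S : Finset V} (h : TC G S) (h5 : 5 ≤ S.card) :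
    ∃ x ∈ S, ∃ y ∈ S, G.Adj x y ∧ TC (contr G x y) (S.erase y) := by
  by_contra hcon
  have hno : ∀ x ∈ S, ∀ y ∈ S, G.Adj x y → ¬ TC (contr G x y) (S.erase y) :=
    fun x hx y hy hxy ht => hcon ⟨x, hx, y, hy, hxy, ht⟩
  have main : ∀ k : ℕ, ∀ (x y a : V) (D : Finset V), D.card = k → x ∈ S → y ∈ S → G.Adj x y →
      D ⊆ S \ {x, y, a} → D.Nonempty →
      (∀ p ∈ D, ∀ q ∈ S \ {x, y, a}, G.Adj p q → q ∈ D) →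
      (∃ o ∈ S \ {x, y, a}, o ∉ D) → False := by
    intro k
    induction k using Nat.strong_induction_on with
    | _ k ih =>
    rintro x y a D hk hx hy hxy hD hne hcl ⟨o, ho, hoD⟩
    obtain ⟨w, hw, a', ha', haD, hwa⟩ := (h.2 {x, y} Finset.card_le_two).exit (D := D) (o := o)
      (fun d hd => by have := hD hd; simp at this ⊢; tauto) hne
      (by simp at ho ⊢; tauto) hoD
    have haa : a' = a := by
      by_contra hne'
      exact haD (hcl w hw a' (by simp at ha' ⊢; tauto) hwa)
    subst haa
    have hwS := hD hw
    simp only [Finset.mem_sdiff, Finset.mem_insert, Finset.mem_singleton, not_or] at ha' hwS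
    have h1 := not_tc_contr h h5 hwa.symm ha'.1 hwS.1 (hno _ ha'.1 _ hwS.1 hwa.symm)
    have h2 : ∃ b, ∃ D1 ⊆ S \ {a', w, b}, D1.Nonempty ∧
      (∀ p ∈ D1, ∀ q ∈ S \ {a', w, b}, G.Adj p q → q ∈ D1) ∧
      (∃ o ∈ S \ {a', w, b}, o ∉ D1) ∧ x ∉ D1 ∧ y ∉ D1 := by
      obtain ⟨b, D1, hD1, hne1, hcl1, o1, ho1, hoD1⟩ := h1
      by_cases hxy1 : x ∉ D1 ∧ y ∉ D1
      · exact ⟨b, D1, hD1, hne1, hcl1, ⟨o1, ho1, hoD1⟩, hxy1⟩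
      · refine ⟨b, (S \ {a', w, b}) \ D1, Finset.sdiff_subset, ⟨o1, by simp only [Finset.mem_sdiff] at ho1 ⊢; exact ⟨ho1, hoD1⟩⟩, ?_, ?_, ?_⟩
        · intro p hp q hq hpq
          rw [Finset.mem_sdiff] at hp ⊢
          exact ⟨hq, fun hq1 => hp.2 (hcl1 q hq1 p hp.1 hpq.symm)⟩
        · obtain ⟨d, hd⟩ := hne1
          exact ⟨d, hD1 hd, fun h => (Finset.mem_sdiff.1 h).2 hd⟩
        · have e1 := hcl1 x
          have e2 := hcl1 y
          constructor
          · intro hx1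
            have hx2 := Finset.mem_sdiff.1 hx1
            have : y ∈ D1 := by tauto
            exact hx2.2 (e2 this x hx2.1 hxy.symm)
          · intro hx1
            have hx2 := Finset.mem_sdiff.1 hx1
            have : x ∈ D1 := by tauto
            exact hx2.2 (e1 this y hx2.1 hxy)
    obtain ⟨b, D1, hD1, hne1, hcl1, ⟨o1, ho1, hoD1⟩, hx1, hy1⟩ := h2
    have hwD1 : w ∉ D1 := fun h => by have := hD1 h; simp at this
    obtain ⟨p, hp, w', hw', hwD', hpw⟩ := (h.2 {a', b} Finset.card_le_two).exit (D := D1) (o := o1)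
      (fun d hd => by have := hD1 hd; simp at this ⊢; tauto) hne1
      (by simp at ho1 ⊢; tauto) hoD1
    have hww : w' = w := by
      by_contra hne'
      exact hwD' (hcl1 p hp w' (by simp at hw' ⊢; tauto) hpw)
    subst hww
    have hxyo : ∀ q ∈ D1, q ∈ S \ {x, y, a'} := by
      intro q hq
      have e1 : q ≠ x := fun h => hx1 (h ▸ hq)
      have e2 : q ≠ y := fun h => hy1 (h ▸ hq)
      have := hD1 hq
      simp at this ⊢
      tauto
    have hpD : p ∈ D := hcl w' hw p (hxyo p hp) hpw.symm
    refine ih (D1 ∩ D).card ?_ a' w' b (D1 ∩ D) rfl ha'.1 hwS.1 hwa.symm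
      (Finset.inter_subset_left.trans hD1) ⟨p, by simp [hp, hpD]⟩ ?_
      ⟨o1, ho1, fun h => hoD1 (Finset.mem_inter.1 h).1⟩
    · rw [← hk]
      apply Finset.card_lt_card
      refine ⟨Finset.inter_subset_right, fun hs => hwD1 (Finset.mem_inter.1 (hs hw)).1⟩
    · intro p' hp' q hq hpq
      rw [Finset.mem_inter] at hp' ⊢
      have hq1 := hcl1 p' hp'.1 q hq hpq
      exact ⟨hq1, hcl p' hp'.2 q (hxyo q hq1) hpq⟩
  have hSne : S.Nonempty := by rw [← Finset.card_pos]; omega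
  obtain ⟨v, hv⟩ := hSne
  obtain ⟨w, hw, -, hvw⟩ := h.nbr_out hv (C := ∅) (by simp) (by simp)
  obtain ⟨a, D, hD, hne, hcl, ho⟩ := not_tc_contr h h5 hvw hv hw (hno _ hv _ hw hvw)
  exact main _ v w a D rfl hv hw hvw hD hne hcl ho

end Thomassen

/-- all edges of `G` have their ends in `S` -/
def Supp {V : Type} (G : SimpleGraph V) (S : Finset V) : Prop := ∀ a b, G.Adj a b → a ∈ S

/-- `T` is a clique -/
def Tri {V : Type} (G : SimpleGraph V) (T : Finset V) : Prop :=
  ∀ a ∈ T, ∀ b ∈ T, a ≠ b → G.Adj a b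

open Classical in
/-- nonseparating triangles -/
noncomputable def FS {V : Type} (G : SimpleGraph V) (S : Finset V) : Finset (Finset V) :=
  (S.powersetCard 3).filter fun T => Tri G T ∧ Conn G (S \ T)

open Classical in
/-- the number of ordered adjacent pairs, i.e. twice the number of edges -/
noncomputable def p2 {V : Type} [Fintype V] (G : SimpleGraph V) : ℕ :=
  (Finset.univ.filter fun p : V × V => G.Adj p.1 p.2).card

section ThreeConn
open Classical
variable {V : Type} {G : SimpleGraph V}

theorem mem_FS {S T : Finset V} :
    T ∈ FS G S ↔ (T ⊆ S ∧ T.card = 3) ∧ Tri G T ∧ Conn G (S \ T) := by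
  simp [FS, Finset.mem_powersetCard]

theorem p2_le [Fintype V] {S : Finset V} (hs : Supp G S) : p2 G ≤ S.card * S.card - S.card := by
  rw [← Finset.offDiag_card]
  apply Finset.card_le_card
  rintro ⟨a, b⟩ h
  simp only [Finset.mem_filter, Finset.mem_univ, true_and] at h
  simp only [Finset.mem_offDiag]
  exact ⟨hs _ _ h, hs _ _ h.symm, h.ne⟩

theorem third {T : Finset V} (h3 : T.card = 3) {a b : V} (ha : a ∈ T) (hb : b ∈ T) (hab : a ≠ b) :
    ∃ c, c ≠ a ∧ c ≠ b ∧ T = {a, b, c} := by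
  have h1 : ((T.erase a).erase b).card = 1 := by
    rw [Finset.card_erase_of_mem (by simp [hb, hab.symm]), Finset.card_erase_of_mem ha, h3]
  obtain ⟨c, hc⟩ := Finset.card_eq_one.1 h1
  have hc' : c ∈ (T.erase a).erase b := by rw [hc]; simp
  simp only [Finset.mem_erase] at hc'
  refine ⟨c, hc'.2.1, hc'.1, ?_⟩
  ext v
  have : v ∈ (T.erase a).erase b ↔ v = c := by rw [hc]; simp
  simp only [Finset.mem_erase] at this
  simp only [Finset.mem_insert, Finset.mem_singleton]
  by_cases h1 : v = a
  · subst h1; simp [ha]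
  by_cases h2 : v = b
  · subst h2; simp [hb]
  tauto

theorem FS_two (hP : G.IsPlanar) {S : Finset V} {a b : V} (hab : a ≠ b) :
    ((FS G S).filter fun T => a ∈ T ∧ b ∈ T).card ≤ 2 := by
  by_contra hcon
  obtain ⟨T1, h1, T2, h2, T3, h3, h12, h13, h23⟩ := Finset.two_lt_card.1 (not_le.1 hcon)
  have key : ∀ T ∈ (FS G S).filter (fun T => a ∈ T ∧ b ∈ T), ∃ c, T = {a, b, c} ∧
      c ∈ S \ {a, b} ∧ G.Adj a c ∧ G.Adj b c ∧ G.Adj a b ∧ Conn G ((S \ {a, b}) \ {c}) := by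
    intro T hT
    rw [Finset.mem_filter, mem_FS] at hT
    obtain ⟨⟨⟨hTS, hT3⟩, htri, hconn⟩, ha, hb⟩ := hT
    obtain ⟨c, hca, hcb, rfl⟩ := third hT3 ha hb hab
    refine ⟨c, rfl, ?_, htri a (by simp) c (by simp) hca.symm, htri b (by simp) c (by simp) hcb.symm,
      htri a (by simp) b (by simp) hab, ?_⟩
    · have := hTS (show c ∈ ({a, b, c} : Finset V) by simp)
      simp [this, hca, hcb]
    · have e : (S \ {a, b}) \ {c} = S \ {a, b, c} := by
        ext v; simp; tauto
      rw [e]; exact hconn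
  obtain ⟨c1, e1, m1, ac1, bc1, hadj, k1⟩ := key T1 h1
  obtain ⟨c2, e2, m2, ac2, bc2, -, k2⟩ := key T2 h2
  obtain ⟨c3, e3, m3, ac3, bc3, -, k3⟩ := key T3 h3
  have n12 : c1 ≠ c2 := by rintro rfl; exact h12 (e1.trans e2.symm)
  have n13 : c1 ≠ c3 := by rintro rfl; exact h13 (e1.trans e3.symm)
  have n23 : c2 ≠ c3 := by rintro rfl; exact h23 (e2.trans e3.symm)
  exact three_ears hP (x := a) (y := b) (W := S \ {a, b}) (A := {c1}) (B := {c2}) (C := {c3}) hadj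
    (by simp) (by simp) (by simpa using m1) (by simpa using m2) (by simpa using m3)
    (by simpa using n12) (by simpa using n13) (by simpa using n23)
    (conn_singleton _) (conn_singleton _) (conn_singleton _) k1 k2 k3
    ⟨a, by simp, c1, by simp, ac1⟩ ⟨a, by simp, c2, by simp, ac2⟩ ⟨a, by simp, c3, by simp, ac3⟩
    ⟨b, by simp, c1, by simp, bc1⟩ ⟨b, by simp, c2, by simp, bc2⟩ ⟨b, by simp, c3, by simp, bc3⟩

/-- two mixed items cannot overlap -/
theorem mixed_overlap (hP : G.IsPlanar) {S : Finset V} (h : TC G S) {x y a b b' : V}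
    (hx : x ∈ S) (hxy : G.Adj x y) (hb : b ∈ S \ {x, y}) (hb' : b' ∈ S \ {x, y})
    (ha : a ∈ S \ {x, y}) (hbb : b ≠ b')
    (xa : G.Adj x a) (yb : G.Adj y b) (xb : ¬ G.Adj x b) (ab : G.Adj a b)
    (yb' : G.Adj y b') (xb' : ¬ G.Adj x b') (ab' : G.Adj a b')
    (c1 : Conn G ((S \ {x, y}) \ {a, b})) (c2 : Conn G ((S \ {x, y}) \ {a, b'})) : False := by
  obtain ⟨c, hcS, hc, hxc⟩ := h.nbr_out hx (C := {y, a}) Finset.card_le_two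
    (by simp [hxy.ne, xa.ne])
  simp only [Finset.mem_insert, Finset.mem_singleton, not_or] at hc
  have hcb : c ≠ b := by rintro rfl; exact xb hxc
  have hcb' : c ≠ b' := by rintro rfl; exact xb' hxc
  simp only [Finset.mem_sdiff, Finset.mem_insert, Finset.mem_singleton, not_or] at hb hb' ha
  obtain ⟨Z, hZ, hcZ, hZc, hZcl⟩ := exists_comp (G := G) ((S \ {x, y}) \ {a, b, b'}) (p := c)
    (by simp [hcS, hc, hcb, hcb', hxc.ne'])
  have hZn : ∀ z ∈ Z, z ∈ S ∧ z ≠ x ∧ z ≠ y ∧ z ≠ a ∧ z ≠ b ∧ z ≠ b' := by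
    intro z hz
    have := hZ hz
    simp at this
    tauto
  have t1 : Touch G Z {b'} := by
    obtain ⟨p, hp, q, hq, hqZ, hpq⟩ := c1.exit (D := Z) (o := b')
      (fun z hz => by have := hZn z hz; simp; tauto) ⟨c, hcZ⟩
      (by simp [hb', hbb.symm, ab'.ne'])
      (fun h => (hZn _ h).2.2.2.2.2 rfl)
    have : q = b' := by
      by_contra hne
      exact hqZ (hZcl p hp q (by simp at hq ⊢; tauto) hpq)
    exact ⟨p, hp, q, by simp [this], hpq⟩
  have t2 : Touch G Z {b} := by
    obtain ⟨p, hp, q, hq, hqZ, hpq⟩ := c2.exit (D := Z) (o := b)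
      (fun z hz => by have := hZn z hz; simp; tauto) ⟨c, hcZ⟩
      (by simp [hb, hbb, ab.ne'])
      (fun h => (hZn _ h).2.2.2.2.1 rfl)
    have : q = b := by
      by_contra hne
      exact hqZ (hZcl p hp q (by simp at hq ⊢; tauto) hpq)
    exact ⟨p, hp, q, by simp [this], hpq⟩
  have t3 : Touch G Z {x} := ⟨c, hcZ, x, by simp, hxc.symm⟩
  have tt : ∀ {u v : V}, G.Adj u v → Touch G {u} {v} := fun {u v} h => ⟨u, by simp, v, by simp, h⟩
  have dj : ∀ {u : V}, u ∉ Z → Disjoint Z {u} := fun {u} h => by simpa using h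
  have nx : x ∉ Z := fun h => (hZn _ h).2.1 rfl
  have ny : y ∉ Z := fun h => (hZn _ h).2.2.1 rfl
  have na : a ∉ Z := fun h => (hZn _ h).2.2.2.1 rfl
  have nb : b ∉ Z := fun h => (hZn _ h).2.2.2.2.1 rfl
  have nb' : b' ∉ Z := fun h => (hZn _ h).2.2.2.2.2 rfl
  refine noK33 hP (A := {a}) (B := {y}) (C := Z) (D := {x}) (E := {b}) (F := {b'}) ?_ ?_ ?_
  · simp [conn_singleton, hZc]
  · simp [ha, hb, hb', nx, ny, na, nb, nb', Finset.disjoint_singleton_left, hxy.ne', ab.ne, ab'.ne, hbb, yb.ne, yb'.ne, Ne.symm ha.2.1, Ne.symm ha.2.2, Ne.symm hb.2.1, Ne.symm hb'.2.1]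
  · intro X hX Y hY
    simp at hX hY
    rcases hX with rfl | rfl | rfl <;> rcases hY with rfl | rfl | rfl
    · exact tt xa.symm
    · exact tt ab
    · exact tt ab'
    · exact tt hxy.symm
    · exact tt yb
    · exact tt yb'
    · exact t3
    · exact t2
    · exact t1

/-- an item attached to the edge `xy` -/
def Item (G : SimpleGraph V) (W : Finset V) (x y : V) (A : Finset V) : Prop :=
  A ⊆ W ∧ Conn G (W \ A) ∧ ((∃ a, A = {a} ∧ G.Adj x a ∧ G.Adj y a) ∨
    ∃ a b, A = {a, b} ∧ G.Adj x a ∧ ¬ G.Adj y a ∧ G.Adj y b ∧ ¬ G.Adj x b ∧ G.Adj a b)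

theorem item_disjoint (hP : G.IsPlanar) {S : Finset V} (h : TC G S) {x y : V}
    (hx : x ∈ S) (hy : y ∈ S) (hxy : G.Adj x y) {A B : Finset V}
    (hA : Item G (S \ {x, y}) x y A) (hB : Item G (S \ {x, y}) x y B) (hAB : A ≠ B) :
    Disjoint A B := by
  obtain ⟨hA1, hA2, hA3⟩ := hA
  obtain ⟨hB1, hB2, hB3⟩ := hB
  rw [Finset.disjoint_left]
  intro v hvA hvB
  rcases hA3 with ⟨a, rfl, xa, ya⟩ | ⟨a, b, rfl, xa, ya, yb, xb, ab⟩ <;>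
  rcases hB3 with ⟨a', rfl, xa', ya'⟩ | ⟨a', b', rfl, xa', ya', yb', xb', ab'⟩
  · simp at hvA hvB
    subst hvA hvB
    exact hAB rfl
  · simp at hvA hvB
    rcases hvB with rfl | rfl <;> subst hvA <;> tauto
  · simp at hvA hvB
    rcases hvA with rfl | rfl <;> subst hvB <;> tauto
  · simp only [Finset.mem_insert, Finset.mem_singleton] at hvA hvB
    have ma : a ∈ S \ {x, y} := hA1 (by simp)
    have mb : b ∈ S \ {x, y} := hA1 (by simp)
    have ma' : a' ∈ S \ {x, y} := hB1 (by simp)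
    have mb' : b' ∈ S \ {x, y} := hB1 (by simp)
    rcases hvA with h1 | h1 <;> rcases hvB with h2 | h2
    · subst h1; subst h2
      have hbb : b ≠ b' := by rintro rfl; exact hAB rfl
      exact mixed_overlap hP h hx hxy mb mb' ma hbb xa yb xb ab yb' xb' ab' hA2 hB2
    · subst h1; subst h2; exact xb' xa
    · subst h1; subst h2; exact xb xa'
    · subst h1; subst h2
      have haa : a ≠ a' := by rintro rfl; exact hAB rfl
      rw [Finset.pair_comm x y] at ma mb ma' hA2 hB2
      rw [Finset.pair_comm _ v] at hA2 hB2
      exact mixed_overlap hP h hy hxy.symm ma ma' mb haa yb xa ya ab.symm xa' ya' ab'.symm hA2 hB2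

theorem item_conn {W A : Finset V} {x y : V} (h : Item G W x y A) : Conn G A := by
  rcases h.2.2 with ⟨a, rfl, -⟩ | ⟨a, b, rfl, -, -, -, -, ab⟩
  · exact conn_singleton _
  · exact conn_pair ab

theorem item_touch {W A : Finset V} {x y : V} (h : Item G W x y A) :
    Touch G {x} A ∧ Touch G {y} A := by
  rcases h.2.2 with ⟨a, rfl, xa, ya⟩ | ⟨a, b, rfl, xa, -, yb, -, ab⟩
  · exact ⟨⟨x, by simp, a, by simp, xa⟩, ⟨y, by simp, a, by simp, ya⟩⟩
  · exact ⟨⟨x, by simp, a, by simp, xa⟩, ⟨y, by simp, b, by simp, yb⟩⟩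

theorem item_two (hP : G.IsPlanar) {S : Finset V} (h : TC G S) {x y : V}
    (hx : x ∈ S) (hy : y ∈ S) (hxy : G.Adj x y) (I : Finset (Finset V))
    (hI : ∀ A ∈ I, Item G (S \ {x, y}) x y A) : I.card ≤ 2 := by
  by_contra hcon
  obtain ⟨A, h1, B, h2, C, h3, h12, h13, h23⟩ := Finset.two_lt_card.1 (not_le.1 hcon)
  have a := hI A h1
  have b := hI B h2
  have c := hI C h3
  exact three_ears hP hxy (W := S \ {x, y}) (by simp) (by simp) a.1 b.1 c.1
    (item_disjoint hP h hx hy hxy a b h12) (item_disjoint hP h hx hy hxy a c h13)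
    (item_disjoint hP h hx hy hxy b c h23) (item_conn a) (item_conn b) (item_conn c)
    a.2.1 b.2.1 c.2.1 (item_touch a).1 (item_touch b).1 (item_touch c).1
    (item_touch a).2 (item_touch b).2 (item_touch c).2

theorem xx_case {S : Finset V} (h : TC G S) {x y a b : V}
    (hx : x ∈ S) (hy : y ∈ S) (hxy : G.Adj x y) (ha : a ∈ S \ {x, y}) (hb : b ∈ S \ {x, y})
    (ab : G.Adj a b) (xa : G.Adj x a) (xb : G.Adj x b) (hc : Conn G ((S \ {x, y}) \ {a, b})) :
    {x, a, b} ∈ FS G S ∨ {y, a, b} ∈ FS G S := by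
  simp only [Finset.mem_sdiff, Finset.mem_insert, Finset.mem_singleton, not_or] at ha hb
  have face : ∀ z z' : V, z ∈ S → z' ∈ S → z ≠ z' → a ≠ z → a ≠ z' → b ≠ z → b ≠ z' →
      (S \ {z, z'}) = S \ {x, y} → G.Adj z a → G.Adj z b →
      (∃ w ∈ (S \ {x, y}) \ {a, b}, G.Adj z' w) → {z, a, b} ∈ FS G S := by
    rintro z z' hz hz' hzz az az' bz bz' hS za zb ⟨w, hw, hw'⟩
    rw [mem_FS]
    refine ⟨⟨?_, ?_⟩, ?_, ?_⟩
    · intro v hv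
      simp at hv
      rcases hv with rfl | rfl | rfl
      · exact hz
      · exact ha.1
      · exact hb.1
    · rw [Finset.card_eq_three]
      exact ⟨z, a, b, Ne.symm az, Ne.symm bz, ab.ne, rfl⟩
    · intro p hp q hq hpq
      simp at hp hq
      rcases hp with rfl | rfl | rfl <;> rcases hq with rfl | rfl | rfl <;>
        first
        | exact absurd rfl hpq
        | assumption
        | (apply SimpleGraph.Adj.symm; assumption)
    · have := hc.insert hw hw'.symm
      have e : S \ {z, a, b} = insert z' ((S \ {x, y}) \ {a, b}) := by
        rw [← hS]
        ext v
        by_cases hv : v = z'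
        · subst hv; simp [hz', hzz.symm, az'.symm, bz'.symm]
        · simp [hv]; tauto
      rw [e]; exact this
  by_cases h1 : ∃ w ∈ (S \ {x, y}) \ {a, b}, G.Adj y w
  · left
    exact face x y hx hy hxy.ne ha.2.1 ha.2.2 hb.2.1 hb.2.2 rfl xa xb h1
  · right
    have h1' : ∀ w ∈ S, G.Adj y w → w = x ∨ w = a ∨ w = b := by
      intro w hw hyw
      by_contra hne
      exact h1 ⟨w, by simp; have := hyw.ne'; tauto, hyw⟩
    have ya : G.Adj y a := by
      obtain ⟨w, hw, hwC, hyw⟩ := h.nbr_out hy (C := {x, b}) Finset.card_le_two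
        (by simp [hxy.ne', Ne.symm hb.2.2])
      have := h1' w hw hyw
      simp at hwC
      have : w = a := by tauto
      exact this ▸ hyw
    have yb : G.Adj y b := by
      obtain ⟨w, hw, hwC, hyw⟩ := h.nbr_out hy (C := {x, a}) Finset.card_le_two
        (by simp [hxy.ne', Ne.symm ha.2.2])
      have := h1' w hw hyw
      simp at hwC
      have : w = b := by tauto
      exact this ▸ hyw
    refine face y x hy hx hxy.ne' ha.2.2 ha.2.1 hb.2.2 hb.2.1 (by rw [Finset.pair_comm]) ya yb ?_
    obtain ⟨o, ho⟩ := hc.1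
    simp at ho
    obtain ⟨p, hp, q, hq, hqD, hpq⟩ := (h.2 {a, b} Finset.card_le_two).exit (D := {x, y}) (o := o)
      (by
        intro v hv
        simp at hv
        rcases hv with rfl | rfl
        · simp [hx, Ne.symm ha.2.1, Ne.symm hb.2.1]
        · simp [hy, Ne.symm ha.2.2, Ne.symm hb.2.2])
      ⟨x, by simp⟩ (by simp; tauto) (by simp; tauto)
    simp at hp hq hqD
    have hqm : q ∈ (S \ {x, y}) \ {a, b} := by simp; tauto
    rcases hp with rfl | rfl
    · exact ⟨q, hqm, hpq⟩
    · exact absurd ⟨q, hqm, hpq⟩ h1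

end ThreeConn

section Step
open Classical
variable {V : Type} {G : SimpleGraph V}

theorem p2_contr [Fintype V] {S : Finset V} (hs : Supp G S) {x y : V} (hxy : G.Adj x y) :
    p2 G ≤ p2 (contr G x y) + 2 + 2 * (S.filter fun a => G.Adj x a ∧ G.Adj y a).card := by
  set N := S.filter fun a => G.Adj x a ∧ G.Adj y a with hN
  set E := Finset.univ.filter fun p : V × V => G.Adj p.1 p.2 with hE
  set E' := Finset.univ.filter fun p : V × V => (contr G x y).Adj p.1 p.2 with hE'
  set R : Finset (V × V) := {(x, y), (y, x)} ∪ (N.image fun a => (y, a)) ∪ (N.image fun a => (a, y))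
    with hR
  have hRc : R.card ≤ 2 + 2 * N.card := by
    have h1 : ({(x, y), (y, x)} : Finset (V × V)).card ≤ 2 := Finset.card_le_two
    have h2 : (N.image fun a => (y, a)).card ≤ N.card := Finset.card_image_le
    have h3 : (N.image fun a => (a, y)).card ≤ N.card := Finset.card_image_le
    have h4 : R.card ≤ ({(x, y), (y, x)} ∪ (N.image fun a => (y, a))).card +
      (N.image fun a => (a, y)).card := Finset.card_union_le _ _
    have h5 := Finset.card_union_le ({(x, y), (y, x)} : Finset (V × V)) (N.image fun a => (y, a))
    omega
  have hmem : ∀ a b, (a, b) ∈ E \ R → G.Adj a b ∧ (a = y → b ≠ x ∧ ¬ G.Adj x b) ∧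
      (b = y → a ≠ x ∧ ¬ G.Adj x a) := by
    intro a b hab
    simp only [hE, hR, Finset.mem_sdiff, Finset.mem_filter, Finset.mem_univ, true_and,
      Finset.mem_union, Finset.mem_insert, Finset.mem_singleton, Prod.mk.injEq,
      Finset.mem_image, not_or, not_exists, hN] at hab
    obtain ⟨hab, ⟨⟨h1, h2⟩, h3⟩, h4⟩ := hab
    refine ⟨hab, ?_, ?_⟩
    · rintro rfl
      refine ⟨fun h => h2 ⟨rfl, h⟩, fun h => h3 b ⟨⟨hs _ _ hab.symm, h, hab⟩, rfl, rfl⟩⟩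
    · rintro rfl
      refine ⟨fun h => h1 ⟨h, rfl⟩, fun h => h4 a ⟨⟨hs _ _ hab, h, hab.symm⟩, rfl, rfl⟩⟩
  have hinj : (E \ R).card ≤ E'.card := by
    apply Finset.card_le_card_of_injOn
      (fun p : V × V => ((if p.1 = y then x else p.1), (if p.2 = y then x else p.2)))
    · rintro ⟨a, b⟩ hab
      obtain ⟨h1, h2, h3⟩ := hmem a b hab
      simp only [hE', Finset.coe_filter, Finset.mem_univ, true_and, Set.mem_ofPred_eq]
      have := h1.ne
      have := h1.symm
      have := hxy.ne
      by_cases ha : a = y <;> by_cases hb : b = y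
      · subst ha; subst hb; exact absurd rfl h1.ne
      · subst ha
        simp only [if_true, hb, if_false]
        exact ⟨Ne.symm (h2 rfl).1, hxy.ne, hb, Or.inr (Or.inl ⟨rfl, h1⟩)⟩
      · subst hb
        simp only [if_true, ha, if_false]
        exact ⟨(h3 rfl).1, ha, hxy.ne, Or.inr (Or.inr ⟨rfl, h1.symm⟩)⟩
      · simp only [ha, hb, if_false]
        exact ⟨h1.ne, ha, hb, Or.inl h1⟩
    · rintro ⟨a, b⟩ hab ⟨c, d⟩ hcd heq
      obtain ⟨h1, h2, h3⟩ := hmem a b hab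
      obtain ⟨k1, k2, k3⟩ := hmem c d hcd
      simp only [Prod.mk.injEq] at heq
      have g1 := h1.symm
      have g2 := k1.symm
      have g3 := h1.ne
      have g4 := k1.ne
      have g5 := hxy.ne
      clear_value E R E' N
      by_cases ha : a = y <;> by_cases hb : b = y <;> by_cases hc : c = y <;> by_cases hd : d = y <;>
        simp only [ha, hb, hc, hd, if_true, if_false] at heq <;> grind
  have : E.card ≤ (E \ R).card + R.card := by
    have := Finset.le_card_sdiff R E
    omega
  show E.card ≤ E'.card + 2 + 2 * N.card
  omega

theorem supp_contr {S : Finset V} (hs : Supp G S) {x y : V} (hx : x ∈ S) :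
    Supp (contr G x y) (S.erase y) := by
  intro a b h
  rw [Finset.mem_erase]
  refine ⟨h.2.1, ?_⟩
  rcases h.2.2.2 with h1 | ⟨h2, h1⟩ | ⟨h2, h1⟩
  · exact hs _ _ h1
  · exact h2 ▸ hx
  · exact hs _ _ h1.symm

set_option maxHeartbeats 1000000 in
theorem FS_contr (hP : G.IsPlanar) {S : Finset V} (h : TC G S) {x y : V}
    (hx : x ∈ S) (hy : y ∈ S) (hxy : G.Adj x y) (h' : TC (contr G x y) (S.erase y)) :
    (FS (contr G x y) (S.erase y)).card + 2 * (S.filter fun a => G.Adj x a ∧ G.Adj y a).card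
      ≤ (FS G S).card + 2 := by
  set N := S.filter fun a => G.Adj x a ∧ G.Adj y a with hN
  set F' := FS (contr G x y) (S.erase y) with hF'
  have hyF' : ∀ T ∈ F', y ∉ T := by
    intro T hT hyT
    have := (mem_FS.1 hT).1.1 hyT
    simp at this
  -- common neighbours
  have hcom : ∀ a ∈ N, a ∈ S \ {x, y} ∧ Conn G ((S \ {x, y}) \ {a}) := by
    intro a ha
    rw [hN, Finset.mem_filter] at ha
    refine ⟨by simp [ha.1, ha.2.1.ne', ha.2.2.ne'], ?_⟩
    have e : (S \ {x, y}) \ {a} = S.erase y \ {x, a} := by ext v; simp; tauto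
    rw [e]
    exact conn_uncontr' (by simp) (h'.2 {x, a} Finset.card_le_two)
  -- faces not containing x
  have hA : ∀ T ∈ F', x ∉ T → T ∈ FS G S := by
    intro T hT hxT
    have hyT := hyF' T hT
    rw [hF', mem_FS] at hT
    obtain ⟨⟨hTS, hT3⟩, htri, hc⟩ := hT
    rw [mem_FS]
    refine ⟨⟨hTS.trans (Finset.erase_subset _ _), hT3⟩, ?_, ?_⟩
    · intro a ha b hb hab
      rcases (htri a ha b hb hab).2.2.2 with h | ⟨rfl, h⟩ | ⟨rfl, h⟩
      · exact h
      · exact absurd ha hxT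
      · exact absurd hb hxT
    · have := conn_uncontr hxy (by simp [hx, hxT, hxy.ne]) hc
      have e : S \ T = insert y (S.erase y \ T) := by
        ext v
        by_cases hv : v = y
        · subst hv; simp [hy, hyT]
        · simp [hv]
      rw [e]; exact this
  -- faces containing x
  have hB : ∀ T ∈ F', x ∈ T → T ∉ FS G S → insert y (T.erase x) ∉ FS G S →
      Item G (S \ {x, y}) x y (T.erase x) ∧ (T.erase x).card = 2 := by
    intro T hT hxT hn1 hn2
    have hyT := hyF' T hT
    rw [hF', mem_FS] at hT
    obtain ⟨⟨hTS, hT3⟩, htri, hc⟩ := hT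
    have hc2 : (T.erase x).card = 2 := by rw [Finset.card_erase_of_mem hxT, hT3]
    refine ⟨?_, hc2⟩
    obtain ⟨a, b, hab, he⟩ := Finset.card_eq_two.1 hc2
    have hTe : T = {x, a, b} := by rw [← he, Finset.insert_erase hxT]
    have hax : a ≠ x := by
      have : a ∈ T.erase x := by rw [he]; simp
      exact Finset.ne_of_mem_erase this
    have hbx : b ≠ x := by
      have : b ∈ T.erase x := by rw [he]; simp
      exact Finset.ne_of_mem_erase this
    rw [he] at hn2 ⊢
    subst hTe
    simp only [Finset.mem_insert, Finset.mem_singleton, not_or] at hyT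
    have haS := Finset.mem_of_mem_erase (hTS (show a ∈ ({x, a, b} : Finset V) by simp))
    have hbS := Finset.mem_of_mem_erase (hTS (show b ∈ ({x, a, b} : Finset V) by simp))
    have ha : a ∈ S \ {x, y} := by simp [haS, hax, Ne.symm hyT.2.1]
    have hb : b ∈ S \ {x, y} := by simp [hbS, hbx, Ne.symm hyT.2.2]
    have hcc : Conn G ((S \ {x, y}) \ {a, b}) := by
      have := conn_uncontr' (by simp) hc
      have e : (S \ {x, y}) \ {a, b} = S.erase y \ {x, a, b} := by ext v; simp; tauto
      rw [e]; exact this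
    have Gab : G.Adj a b := by
      have := (htri a (by simp) b (by simp) hab).2.2.2
      tauto
    have Gxa : G.Adj x a ∨ G.Adj y a := by
      have := (htri x (by simp) a (by simp) hax.symm).2.2.2
      tauto
    have Gxb : G.Adj x b ∨ G.Adj y b := by
      have := (htri x (by simp) b (by simp) hbx.symm).2.2.2
      tauto
    have nxx : ¬ (G.Adj x a ∧ G.Adj x b) := by
      rintro ⟨h1, h2⟩
      have := xx_case h hx hy hxy ha hb Gab h1 h2 hcc
      tauto
    have nyy : ¬ (G.Adj y a ∧ G.Adj y b) := by
      rintro ⟨h1, h2⟩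
      have := xx_case h hy hx hxy.symm (by rwa [Finset.pair_comm y x]) (by rwa [Finset.pair_comm y x])
        Gab h1 h2 (by rwa [Finset.pair_comm y x])
      tauto
    refine ⟨?_, hcc, Or.inr ?_⟩
    · intro v hv
      simp only [Finset.mem_insert, Finset.mem_singleton] at hv
      rcases hv with rfl | rfl
      · exact ha
      · exact hb
    · by_cases hxa : G.Adj x a
      · exact ⟨a, b, rfl, hxa, by tauto, by tauto, by tauto, Gab⟩
      · exact ⟨b, a, Finset.pair_comm _ _, by tauto, by tauto, by tauto, by tauto, Gab.symm⟩
  set Good := F'.filter fun T => T ∈ FS G S ∨ insert y (T.erase x) ∈ FS G S with hGood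
  set Bad := F'.filter fun T => ¬ (T ∈ FS G S ∨ insert y (T.erase x) ∈ FS G S) with hBad
  have hsum : Good.card + Bad.card = F'.card := Finset.card_filter_add_card_filter_not _
  have hbadx : ∀ T ∈ Bad, x ∈ T := by
    intro T hT
    rw [hBad, Finset.mem_filter] at hT
    by_contra hxT
    exact hT.2 (Or.inl (hA T hT.1 hxT))
  have hbad : Bad.card + N.card ≤ 2 := by
    have hit := item_two hP h hx hy hxy ((Bad.image fun T => T.erase x) ∪ N.image fun a => {a}) (by
      intro A hA'
      rw [Finset.mem_union, Finset.mem_image, Finset.mem_image] at hA'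
      rcases hA' with ⟨T, hT, rfl⟩ | ⟨a, ha, rfl⟩
      · have hxT := hbadx T hT
        rw [hBad, Finset.mem_filter] at hT
        exact (hB T hT.1 hxT (fun hh => hT.2 (Or.inl hh)) (fun hh => hT.2 (Or.inr hh))).1
      · have h1 := hcom a ha
        rw [hN, Finset.mem_filter] at ha
        exact ⟨by simpa using h1.1, h1.2, Or.inl ⟨a, rfl, ha.2.1, ha.2.2⟩⟩)
    rw [Finset.card_union_of_disjoint, Finset.card_image_of_injOn, Finset.card_image_of_injective]
      at hit
    · exact hit
    · exact Finset.singleton_injective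
    · intro T hT T' hT' he
      have he' : T.erase x = T'.erase x := he
      rw [← Finset.insert_erase (hbadx T hT), ← Finset.insert_erase (hbadx T' hT'), he']
    · rw [Finset.disjoint_left]
      intro A h1 h2
      rw [Finset.mem_image] at h1 h2
      obtain ⟨T, hT, rfl⟩ := h1
      obtain ⟨a, ha, hae⟩ := h2
      have hxT := hbadx T hT
      rw [hBad, Finset.mem_filter] at hT
      have := (hB T hT.1 hxT (fun hh => hT.2 (Or.inl hh)) (fun hh => hT.2 (Or.inr hh))).2
      rw [← hae] at this
      simp at this
  have hgood : Good.card + N.card ≤ (FS G S).card := by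
    have h1 : Good.card ≤ ((FS G S).filter fun T => ¬ (x ∈ T ∧ y ∈ T)).card := by
      apply Finset.card_le_card_of_injOn
        (fun T => if T ∈ FS G S then T else insert y (T.erase x))
      · intro T hT
        rw [hGood, Finset.mem_coe, Finset.mem_filter] at hT
        have hyT := hyF' T hT.1
        have hne := hxy.ne
        simp only [Finset.coe_filter, Set.mem_ofPred_eq]
        by_cases hTF : T ∈ FS G S
        · simp only [hTF, if_true, true_and]; tauto
        · simp only [hTF, if_false]
          refine ⟨by tauto, ?_⟩
          simp [hne]
      · intro T hT T' hT' he
        rw [hGood, Finset.mem_coe, Finset.mem_filter] at hT hT'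
        have hyT := hyF' T hT.1
        have hyT' := hyF' T' hT'.1
        by_cases hTF : T ∈ FS G S <;> by_cases hTF' : T' ∈ FS G S <;>
          simp only [hTF, hTF', if_true, if_false] at he
        · exact he
        · exfalso; apply hyT; rw [he]; simp
        · exfalso; apply hyT'; rw [← he]; simp
        · have hxT : x ∈ T := by
            by_contra hh
            exact hTF (hA T hT.1 hh)
          have hxT' : x ∈ T' := by
            by_contra hh
            exact hTF' (hA T' hT'.1 hh)
          have e1 : T.erase x = T'.erase x := by
            have := congrArg (fun Z => Z.erase y) he
            rwa [Finset.erase_insert (by simp [hyT]), Finset.erase_insert (by simp [hyT'])] at this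
          rw [← Finset.insert_erase hxT, ← Finset.insert_erase hxT', e1]
    have h2 : N.card ≤ ((FS G S).filter fun T => (x ∈ T ∧ y ∈ T)).card := by
      apply Finset.card_le_card_of_injOn (fun a => {x, y, a})
      · intro a ha
        have h1 := hcom a ha
        rw [hN, Finset.mem_coe, Finset.mem_filter] at ha
        simp only [Finset.coe_filter, Set.mem_ofPred_eq]
        refine ⟨?_, by simp, by simp⟩
        rw [mem_FS]
        refine ⟨⟨?_, ?_⟩, ?_, ?_⟩
        · intro v hv
          simp at hv
          rcases hv with rfl | rfl | rfl
          · exact hx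
          · exact hy
          · exact ha.1
        · rw [Finset.card_eq_three]
          exact ⟨x, y, a, hxy.ne, ha.2.1.ne, ha.2.2.ne, rfl⟩
        · obtain ⟨_, xa, ya⟩ := ha
          intro p hp q hq hpq
          simp at hp hq
          rcases hp with rfl | rfl | rfl <;> rcases hq with rfl | rfl | rfl <;>
            first
            | exact absurd rfl hpq
            | assumption
            | (apply SimpleGraph.Adj.symm; assumption)
        · have e : S \ {x, y, a} = (S \ {x, y}) \ {a} := by ext v; simp; tauto
          rw [e]; exact h1.2
      · intro a ha b hb he
        have h1 := (hcom a ha).1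
        have h2 := (hcom b hb).1
        simp only [Finset.mem_sdiff, Finset.mem_insert, Finset.mem_singleton, not_or] at h1 h2
        have : a ∈ ({x, y, b} : Finset V) := by
          have he' : ({x, y, a} : Finset V) = {x, y, b} := he
          rw [← he']; simp
        simp at this
        tauto
    have h3 := Finset.card_filter_add_card_filter_not (s := FS G S) (fun T => (x ∈ T ∧ y ∈ T))
    omega
  omega

theorem L3_aux [Fintype V] : ∀ k : ℕ, ∀ (G : SimpleGraph V) (S : Finset V), S.card = k →
    G.IsPlanar → Supp G S → TC G S → p2 G + 8 ≤ (FS G S).card + 4 * S.card := by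
  intro k
  induction k with
  | zero =>
    intro G S hk _ _ h
    have := h.1
    omega
  | succ k ih =>
    intro G S hk hP hs h
    by_cases h5 : 5 ≤ S.card
    · obtain ⟨x, hx, y, hy, hxy, h'⟩ := thomassen h h5
      have hcard : (S.erase y).card = k := by rw [Finset.card_erase_of_mem hy]; omega
      have h1 := ih (contr G x y) (S.erase y) hcard (planar_contr hxy hP) (supp_contr hs hx) h'
      have h2 := FS_contr hP h hx hy hxy h'
      have h3 := p2_contr hs hxy
      omega
    · have h4 : S.card = 4 := by have := h.1; omega
      have h6 := p2_le hs
      have hadj : ∀ a ∈ S, ∀ b ∈ S, a ≠ b → G.Adj a b := by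
        intro a ha b hb hab
        obtain ⟨p, hp, q, hq, hqD, hpq⟩ := (h.2 ((S.erase a).erase b) (by
          rw [Finset.card_erase_of_mem (by simp [hb, hab.symm]), Finset.card_erase_of_mem ha, h4])).exit
          (D := {a}) (o := b) (by simp [ha]) (by simp) (by simp [hb]) (by simp [hab.symm])
        simp at hp hq hqD
        have : q = b := by tauto
        subst this; subst hp
        exact hpq
      have h7 : FS G S = S.powersetCard 3 := by
        apply Finset.filter_true_of_mem
        intro T hT
        rw [Finset.mem_powersetCard] at hT
        refine ⟨fun a ha b hb => hadj a (hT.1 ha) b (hT.1 hb), ?_⟩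
        have : (S \ T).card = 1 := by rw [Finset.card_sdiff_of_subset hT.1]; omega
        obtain ⟨c, hc⟩ := Finset.card_eq_one.1 this
        rw [hc]
        exact conn_singleton _
      have h8 : (FS G S).card = 4 := by
        rw [h7, Finset.card_powersetCard, h4]; rfl
      rw [h4] at h6
      omega

theorem L3 [Fintype V] {S : Finset V} (hP : G.IsPlanar) (hs : Supp G S) (h : TC G S) :
    p2 G + 8 ≤ (FS G S).card + 4 * S.card := L3_aux _ G S rfl hP hs h

end Step

/-- a system of triangles behaving like a set of triangular faces -/
def FaceSys {V : Type} [Fintype V] [DecidableEq V] (G : SimpleGraph V) (S : Finset V)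
    (F : Finset (Finset V)) : Prop :=
  (∀ T ∈ F, T.card = 3 ∧ Tri G T) ∧
  (∀ a b, a ≠ b → (F.filter fun T => a ∈ T ∧ b ∈ T).card ≤ 2) ∧
  p2 G + 8 ≤ F.card + 4 * S.card ∧
  (∀ Q : Finset V, Q.card = 4 → Q.powersetCard 3 ⊆ F → S.card = 4)

section Faces
open Classical
variable {V : Type} {G : SimpleGraph V}

theorem Tri.subset {S T : Finset V} (hs : Supp G S) (h3 : T.card = 3) (ht : Tri G T) : T ⊆ S := by
  intro a ha
  obtain ⟨b, hb, hba⟩ := Finset.exists_mem_ne (by omega : 1 < T.card) a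
  exact hs a b (ht a ha b hb hba.symm)

theorem four_ge {Q : Finset V} (h4 : Q.card = 4) {x y : V} (hx : x ∈ Q) (hy : y ∈ Q) (hxy : x ≠ y) :
    2 ≤ ((Q.powersetCard 3).filter fun T => x ∈ T ∧ y ∈ T).card := by
  have hc : (Q \ {x, y}).card = 2 := by
    rw [Finset.card_sdiff_of_subset (by intro v hv; simp at hv; rcases hv with rfl | rfl <;> assumption),
      h4, Finset.card_pair hxy]
  rw [← hc]
  apply Finset.card_le_card_of_injOn (fun c => {x, y, c})
  · intro c hc
    simp at hc
    simp only [Finset.coe_filter, Set.mem_ofPred_eq, Finset.mem_powersetCard]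
    refine ⟨⟨?_, ?_⟩, by simp, by simp⟩
    · intro v hv
      simp at hv
      rcases hv with rfl | rfl | rfl
      · exact hx
      · exact hy
      · exact hc.1
    · rw [Finset.card_eq_three]
      exact ⟨x, y, c, hxy, fun h => hc.2.1 h.symm, fun h => hc.2.2 h.symm, rfl⟩
  · intro a ha b hb he
    simp at ha hb
    have : a ∈ ({x, y, b} : Finset V) := by
      have he' : ({x, y, a} : Finset V) = {x, y, b} := he
      rw [← he']; simp
    simp at this
    tauto

theorem four_le {Q : Finset V} (h4 : Q.card = 4) {x y : V} (hxy : x ≠ y) :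
    ((Q.powersetCard 3).filter fun T => x ∈ T ∧ y ∈ T).card ≤ 2 := by
  by_cases hm : x ∈ Q ∧ y ∈ Q
  · have hc : ((Q \ {x, y}).powersetCard 1).card = 2 := by
      rw [Finset.card_powersetCard, Finset.card_sdiff_of_subset (by
        intro v hv; simp at hv; rcases hv with rfl | rfl
        · exact hm.1
        · exact hm.2), h4, Finset.card_pair hxy]
      rfl
    rw [← hc]
    apply Finset.card_le_card_of_injOn (fun T => Q \ T)
    · intro T hT
      simp only [Finset.coe_filter, Set.mem_ofPred_eq, Finset.mem_powersetCard] at hT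
      simp only [Finset.mem_coe, Finset.mem_powersetCard]
      refine ⟨?_, by rw [Finset.card_sdiff_of_subset hT.1.1]; omega⟩
      intro v hv
      simp at hv ⊢
      refine ⟨hv.1, ?_, ?_⟩
      · rintro rfl; exact hv.2 hT.2.1
      · rintro rfl; exact hv.2 hT.2.2
    · intro T hT T' hT' he
      simp only [Finset.coe_filter, Set.mem_ofPred_eq, Finset.mem_powersetCard] at hT hT'
      have he' : Q \ T = Q \ T' := he
      rw [← Finset.sdiff_sdiff_eq_self hT.1.1, ← Finset.sdiff_sdiff_eq_self hT'.1.1, he']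
  · have : ((Q.powersetCard 3).filter fun T => x ∈ T ∧ y ∈ T) = ∅ := by
      apply Finset.filter_false_of_mem
      intro T hT hxy
      rw [Finset.mem_powersetCard] at hT
      exact hm ⟨hT.1 hxy.1, hT.1 hxy.2⟩
    rw [this]; simp

theorem four_ex {Q : Finset V} (h4 : Q.card = 4) {x y : V} (hx : x ∈ Q) (hy : y ∈ Q) (hxy : x ≠ y) :
    ∃ T ∈ Q.powersetCard 3, x ∈ T ∧ y ∈ T := by
  have h1 := four_ge h4 hx hy hxy
  have : ((Q.powersetCard 3).filter fun T => x ∈ T ∧ y ∈ T).Nonempty := by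
    rw [← Finset.card_pos]; omega
  obtain ⟨T, hT⟩ := this
  rw [Finset.mem_filter] at hT
  exact ⟨T, hT.1, hT.2⟩

theorem four_ex1 {Q : Finset V} (h4 : Q.card = 4) {x : V} (hx : x ∈ Q) :
    ∃ T ∈ Q.powersetCard 3, x ∈ T := by
  obtain ⟨y, hy, hyx⟩ := Finset.exists_mem_ne (by omega : 1 < Q.card) x
  obtain ⟨T, hT, hxT, -⟩ := four_ex h4 hx hy hyx.symm
  exact ⟨T, hT, hxT⟩

theorem four_eq {Q A : Finset V} {F : Finset (Finset V)} (h4 : Q.card = 4) (hA : A.card = 4)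
    (hF : ∀ T ∈ F, T ⊆ A) (hQ : Q.powersetCard 3 ⊆ F) : Q = A := by
  apply Finset.eq_of_subset_of_card_le
  · intro x hx
    obtain ⟨T, hT, hxT⟩ := four_ex1 h4 hx
    exact hF T (hQ hT) hxT
  · omega

theorem four_clique {Q : Finset V} {F : Finset (Finset V)} (h4 : Q.card = 4)
    (hF : ∀ T ∈ F, Tri G T) (hQ : Q.powersetCard 3 ⊆ F) : Tri G Q := by
  intro a ha b hb hab
  obtain ⟨T, hT, haT, hbT⟩ := four_ex h4 ha hb hab
  exact hF T (hQ hT) a haT b hbT hab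

/-- base case -/
theorem faces_four [Fintype V] {S : Finset V} (hs : Supp G S) (h4 : S.card = 4) :
    ∃ F, FaceSys G S F := by
  refine ⟨(S.powersetCard 3).filter (Tri G), ?_, ?_, ?_, fun _ _ _ => h4⟩
  · intro T hT
    rw [Finset.mem_filter, Finset.mem_powersetCard] at hT
    exact ⟨hT.1.2, hT.2⟩
  · intro a b hab
    refine le_trans (Finset.card_le_card ?_) (four_le h4 hab)
    exact Finset.filter_subset_filter _ (Finset.filter_subset _ _)
  · set F := (S.powersetCard 3).filter (Tri G) with hF
    set N := (S.powersetCard 3).filter (fun T => ¬ Tri G T) with hN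
    set t := S.offDiag.filter (fun p : V × V => ¬ G.Adj p.1 p.2) with ht
    have h1 : F.card + N.card = 4 := by
      rw [Finset.card_filter_add_card_filter_not, Finset.card_powersetCard, h4]; rfl
    have h2 : p2 G + t.card ≤ 12 := by
      have e1 : (S.offDiag.filter (fun p : V × V => G.Adj p.1 p.2)).card + t.card =
          S.offDiag.card := Finset.card_filter_add_card_filter_not _
      rw [Finset.offDiag_card, h4] at e1
      have e2 : p2 G ≤ (S.offDiag.filter (fun p : V × V => G.Adj p.1 p.2)).card := by
        apply Finset.card_le_card
        rintro ⟨a, b⟩ h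
        simp only [Finset.mem_filter, Finset.mem_univ, true_and] at h
        simp only [Finset.mem_filter, Finset.mem_offDiag]
        exact ⟨⟨hs _ _ h, hs _ _ h.symm, h.ne⟩, h⟩
      omega
    have h3 : N.card * 2 ≤ t.card * 2 := by
      apply Finset.card_mul_le_card_mul (fun (T : Finset V) (p : V × V) => p.1 ∈ T ∧ p.2 ∈ T)
      · intro T hT
        rw [hN, Finset.mem_filter, Finset.mem_powersetCard] at hT
        obtain ⟨hT1, hT2⟩ := hT
        unfold Tri at hT2
        push Not at hT2
        obtain ⟨a, ha, b, hb, hab, hnab⟩ := hT2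
        have hpair : ({(a, b), (b, a)} : Finset (V × V)).card = 2 := by
          rw [Finset.card_pair]
          intro h
          exact hab (Prod.mk.inj h).1
        rw [← hpair]
        apply Finset.card_le_card
        intro p hp
        simp only [Finset.mem_insert, Finset.mem_singleton] at hp
        rw [Finset.mem_bipartiteAbove, ht, Finset.mem_filter, Finset.mem_offDiag]
        rcases hp with rfl | rfl
        · exact ⟨⟨⟨hT1.1 ha, hT1.1 hb, hab⟩, hnab⟩, ha, hb⟩
        · exact ⟨⟨⟨hT1.1 hb, hT1.1 ha, hab.symm⟩, fun h => hnab h.symm⟩, hb, ha⟩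
      · rintro ⟨a, b⟩ hp
        rw [ht, Finset.mem_filter, Finset.mem_offDiag] at hp
        refine le_trans (Finset.card_le_card ?_) (four_le h4 hp.1.2.2)
        intro T hT
        rw [Finset.mem_bipartiteBelow] at hT
        rw [Finset.mem_filter]
        exact ⟨(Finset.mem_filter.1 hT.1).1, hT.2⟩
    omega

/-- the three-connected case -/
theorem faces_tc [Fintype V] {S : Finset V} (hP : G.IsPlanar) (hs : Supp G S) (h : TC G S) :
    ∃ F, FaceSys G S F := by
  refine ⟨FS G S, ?_, fun a b hab => FS_two hP hab, L3 hP hs h, ?_⟩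
  · intro T hT
    rw [mem_FS] at hT
    exact ⟨hT.1.2, hT.2.1⟩
  intro Q hQ hQF
  by_contra h4
  have h5 : 5 ≤ S.card := by have := h.1; omega
  have hQc : Tri G Q := four_clique hQ (fun T hT => (mem_FS.1 hT).2.1) hQF
  have hQS : Q ⊆ S := by
    intro x hx
    obtain ⟨T, hT, hxT⟩ := four_ex1 hQ hx
    exact (mem_FS.1 (hQF hT)).1.1 hxT
  have hne : (S \ Q).Nonempty := by
    rw [← Finset.card_pos, Finset.card_sdiff_of_subset hQS]; omega
  obtain ⟨p, hp⟩ := hne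
  obtain ⟨Z, hZ, hpZ, hZc, hZcl⟩ := exists_comp (G := G) (S \ Q) hp
  have hZQ : ∀ q ∈ Q, q ∉ Z := fun q hq hqZ => (Finset.mem_sdiff.1 (hZ hqZ)).2 hq
  have ht : ∀ q ∈ Q, Touch G Z {q} := by
    intro q hq
    have hT := (mem_FS.1 (hQF (show Q.erase q ∈ Q.powersetCard 3 by
      rw [Finset.mem_powersetCard, Finset.card_erase_of_mem hq, hQ]
      exact ⟨Finset.erase_subset _ _, rfl⟩))).2.2
    obtain ⟨a, ha, b, hb, hbZ, hab⟩ := hT.exit (D := Z) (o := q)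
      (by intro z hz; have := hZ hz; simp at this ⊢; tauto) ⟨p, hpZ⟩
      (by simp [hQS hq]) (hZQ q hq)
    have : b = q := by
      by_contra hne
      exact hbZ (hZcl a ha b (by simp at hb ⊢; tauto) hab)
    exact ⟨a, ha, b, by simp [this], hab⟩
  obtain ⟨a, b, c, d, hab, hac, had, hbc, hbd, hcd, rfl⟩ := Finset.card_eq_four.1 hQ
  have tt : ∀ {u v : V}, G.Adj u v → Touch G {u} {v} := fun {u v} h => ⟨u, by simp, v, by simp, h⟩
  refine noK5 hP (A := Z) (B := {a}) (C := {b}) (D := {c}) (E := {d}) ?_ ?_ ?_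
  · simp [conn_singleton, hZc]
  · simp at hZQ
    simp [hab, hac, had, hbc, hbd, hcd, hZQ]
  · simp only [List.pairwise_cons, List.mem_cons, List.not_mem_nil, or_false, forall_eq_or_imp,
      forall_eq, List.Pairwise.nil, and_true, false_implies, implies_true]
    refine ⟨⟨ht a (by simp), ht b (by simp), ht c (by simp), ht d (by simp)⟩,
      ⟨tt (hQc a (by simp) b (by simp) hab), tt (hQc a (by simp) c (by simp) hac),
        tt (hQc a (by simp) d (by simp) had)⟩,
      ⟨tt (hQc b (by simp) c (by simp) hbc), tt (hQc b (by simp) d (by simp) hbd)⟩,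
      tt (hQc c (by simp) d (by simp) hcd)⟩

/-- trimming one side of a small separation -/
theorem trim [Fintype V] {A C : Finset V} {F : Finset (Finset V)} (hCA : C ⊆ A) (hC : C.card ≤ 2)
    (hFA : ∀ T ∈ F, T ⊆ A) (hFt : ∀ T ∈ F, T.card = 3 ∧ Tri G T)
    (hF2 : ∀ a b, a ≠ b → (F.filter fun T => a ∈ T ∧ b ∈ T).card ≤ 2)
    (hF4 : ∀ Q : Finset V, Q.card = 4 → Q.powersetCard 3 ⊆ F → A.card = 4) :
    ∃ F' ⊆ F, 2 * F.card + 4 * C.card ≤ 2 * F'.card + 8 + p2 (restr G C) ∧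
      (∀ x ∈ C, ∀ y ∈ C, x ≠ y → (F'.filter fun T => x ∈ T ∧ y ∈ T).card ≤ 1) ∧
      ∀ Q : Finset V, Q.card = 4 → ¬ (Q.powersetCard 3 ⊆ F') := by
  rcases Nat.lt_or_ge C.card 2 with hC1 | hC2
  · have hvac : ∀ x ∈ C, ∀ y ∈ C, x ≠ y → False := by
      intro x hx y hy hxy
      exact hxy (Finset.card_le_one.1 (by omega) x hx y hy)
    rcases F.eq_empty_or_nonempty with rfl | ⟨T0, hT0⟩
    · refine ⟨∅, subset_rfl, by simp; omega, fun x hx y hy hxy => (hvac x hx y hy hxy).elim, ?_⟩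
      intro Q hQ hsub
      have := Finset.card_le_card hsub
      rw [Finset.card_powersetCard, hQ] at this
      simp [Nat.choose] at this
    · refine ⟨F.erase T0, Finset.erase_subset _ _, ?_,
        fun x hx y hy hxy => (hvac x hx y hy hxy).elim, ?_⟩
      · rw [Finset.card_erase_of_mem hT0]; omega
      · intro Q hQ hsub
        have hsub' := hsub.trans (Finset.erase_subset _ _)
        have hA := hF4 Q hQ hsub'
        have hQA := four_eq hQ hA hFA hsub'
        have : T0 ∈ F.erase T0 := hsub (by
          rw [Finset.mem_powersetCard, hQA]
          exact ⟨hFA T0 hT0, (hFt T0 hT0).1⟩)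
        simp at this
  · obtain ⟨x, y, hxy, rfl⟩ := Finset.card_eq_two.1 (le_antisymm hC hC2)
    have hcore : ∃ F' ⊆ F, 2 * F.card ≤ 2 * F'.card + p2 (restr G {x, y}) ∧
        (F'.filter fun T => x ∈ T ∧ y ∈ T).card ≤ 1 := by
      by_cases hadj : G.Adj x y
      · have hp : 2 ≤ p2 (restr G {x, y}) := by
          have hpair : ({(x, y), (y, x)} : Finset (V × V)).card = 2 := by
            rw [Finset.card_pair]
            intro h
            exact hxy (Prod.mk.inj h).1
          rw [← hpair]
          apply Finset.card_le_card
          intro p hp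
          simp only [Finset.mem_insert, Finset.mem_singleton] at hp
          rw [Finset.mem_filter]
          refine ⟨Finset.mem_univ _, ?_⟩
          rcases hp with rfl | rfl
          · exact ⟨hadj, by simp, by simp⟩
          · exact ⟨hadj.symm, by simp, by simp⟩
        by_cases hex : ∃ T0 ∈ F, x ∈ T0 ∧ y ∈ T0
        · obtain ⟨T0, hT0, hxyT⟩ := hex
          refine ⟨F.erase T0, Finset.erase_subset _ _, ?_, ?_⟩
          · rw [Finset.card_erase_of_mem hT0]; omega
          · have e : ((F.erase T0).filter fun T => x ∈ T ∧ y ∈ T) =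
                (F.filter fun T => x ∈ T ∧ y ∈ T).erase T0 := by
              ext T; simp; tauto
            have := hF2 x y hxy
            rw [e, Finset.card_erase_of_mem (by rw [Finset.mem_filter]; exact ⟨hT0, hxyT⟩)]
            omega
        · refine ⟨F, subset_rfl, by omega, ?_⟩
          rw [Finset.filter_false_of_mem]
          · simp
          · intro T hT h
            exact hex ⟨T, hT, h⟩
      · refine ⟨F, subset_rfl, by omega, ?_⟩
        rw [Finset.filter_false_of_mem]
        · simp
        · intro T hT h
          exact hadj ((hFt T hT).2 x h.1 y h.2 hxy)
    obtain ⟨F', hF', hcard, hfil⟩ := hcore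
    refine ⟨F', hF', by rw [Finset.card_pair hxy]; omega, ?_, ?_⟩
    · intro a ha b hb hab
      simp only [Finset.mem_insert, Finset.mem_singleton] at ha hb
      rcases ha with rfl | rfl <;> rcases hb with rfl | rfl
      · exact absurd rfl hab
      · exact hfil
      · simpa only [and_comm] using hfil
      · exact absurd rfl hab
    · intro Q hQ hsub
      have hsub' := hsub.trans hF'
      have hQA := four_eq hQ (hF4 Q hQ hsub') hFA hsub'
      have h1 := four_ge hQ (hQA ▸ hCA (by simp)) (hQA ▸ hCA (by simp)) hxy
      have h2 := Finset.card_le_card (Finset.filter_subset_filter (fun T => x ∈ T ∧ y ∈ T) hsub)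
      omega

theorem supp_restr (A : Finset V) : Supp (restr G A) A := fun _ _ h => h.2.1

theorem Tri.of_restr {A T : Finset V} (h : Tri (restr G A) T) : Tri G T :=
  fun a ha b hb hab => (h a ha b hb hab).1

/-- gluing along a small separation -/
theorem faces_glue [Fintype V] {S C D : Finset V} (hs : Supp G S) (hCS : C ⊆ S) (hC : C.card ≤ 2)
    (hD : D ⊆ S \ C) (hcl : ∀ p ∈ D, ∀ q ∈ S \ C, G.Adj p q → q ∈ D)
    {F1 F2 : Finset (Finset V)} (h1 : FaceSys (restr G (D ∪ C)) (D ∪ C) F1)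
    (h2 : FaceSys (restr G (S \ D)) (S \ D) F2) : ∃ F, FaceSys G S F := by
  set A := D ∪ C with hA
  set B := S \ D with hB
  have hDS : ∀ d ∈ D, d ∈ S ∧ d ∉ C := fun d hd => Finset.mem_sdiff.1 (hD hd)
  have hAB : ∀ v, v ∈ A → v ∈ B → v ∈ C := by
    intro v hvA hvB
    simp only [hA, hB, Finset.mem_union, Finset.mem_sdiff] at hvA hvB
    tauto
  have hCA : C ⊆ A := Finset.subset_union_right
  have hCB : C ⊆ B := by
    intro v hv
    rw [hB, Finset.mem_sdiff]
    exact ⟨hCS hv, fun h => (hDS v h).2 hv⟩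
  have hF1A : ∀ T ∈ F1, T ⊆ A := fun T hT => Tri.subset (supp_restr A) (h1.1 T hT).1 (h1.1 T hT).2
  have hF2B : ∀ T ∈ F2, T ⊆ B := fun T hT => Tri.subset (supp_restr B) (h2.1 T hT).1 (h2.1 T hT).2
  obtain ⟨F1', hF1, hc1, hx1, hq1⟩ := trim (G := G) hCA hC hF1A
    (fun T hT => ⟨(h1.1 T hT).1, (h1.1 T hT).2.of_restr⟩) h1.2.1 h1.2.2.2
  obtain ⟨F2', hF2, hc2, hx2, hq2⟩ := trim (G := G) hCB hC hF2B
    (fun T hT => ⟨(h2.1 T hT).1, (h2.1 T hT).2.of_restr⟩) h2.2.1 h2.2.2.2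
  have hside : ∀ T : Finset V, 3 ≤ T.card → T ⊆ A → T ⊆ B → False := by
    intro T hT hTA hTB
    have : T ⊆ C := fun v hv => hAB v (hTA hv) (hTB hv)
    have := Finset.card_le_card this
    omega
  have hdis : Disjoint F1' F2' := by
    rw [Finset.disjoint_left]
    intro T hT1 hT2
    exact hside T (h1.1 T (hF1 hT1)).1.ge (hF1A T (hF1 hT1)) (hF2B T (hF2 hT2))
  have htri : ∀ T ∈ F1' ∪ F2', T.card = 3 ∧ Tri G T := by
    intro T hT
    rw [Finset.mem_union] at hT
    rcases hT with hT | hT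
    · exact ⟨(h1.1 T (hF1 hT)).1, (h1.1 T (hF1 hT)).2.of_restr⟩
    · exact ⟨(h2.1 T (hF2 hT)).1, (h2.1 T (hF2 hT)).2.of_restr⟩
  have hcardAB : A.card + B.card = S.card + C.card := by
    have e1 : A.card = D.card + C.card := Finset.card_union_of_disjoint
      (Finset.disjoint_left.2 fun d hd => (hDS d hd).2)
    have e2 : B.card = S.card - D.card := Finset.card_sdiff_of_subset fun d hd => (hDS d hd).1
    have e3 := Finset.card_le_card (show D ⊆ S from fun d hd => (hDS d hd).1)
    omega
  have hp : p2 G + p2 (restr G C) ≤ p2 (restr G A) + p2 (restr G B) := by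
    unfold p2
    rw [← Finset.card_union_add_card_inter (Finset.univ.filter fun p : V × V => (restr G A).Adj p.1 p.2)]
    apply Nat.add_le_add
    · apply Finset.card_le_card
      rintro ⟨a, b⟩ hab
      simp only [Finset.mem_filter, Finset.mem_univ, true_and, Finset.mem_union] at hab ⊢
      have haS := hs _ _ hab
      have hbS := hs _ _ hab.symm
      have k1 := hcl a
      have k2 := hcl b
      by_cases haD : a ∈ D
      · left
        refine ⟨hab, by simp [hA, haD], ?_⟩
        by_cases hbC : b ∈ C
        · exact hCA hbC
        · simp only [hA, Finset.mem_union]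
          exact Or.inl (hcl a haD b (by simp [hbS, hbC]) hab)
      · by_cases hbD : b ∈ D
        · left
          refine ⟨hab, ?_, by simp [hA, hbD]⟩
          by_cases haC : a ∈ C
          · exact hCA haC
          · exact absurd (hcl b hbD a (by simp [haS, haC]) hab.symm) haD
        · right
          exact ⟨hab, by simp [hB, haS, haD], by simp [hB, hbS, hbD]⟩
    · apply Finset.card_le_card
      rintro ⟨a, b⟩ hab
      simp only [Finset.mem_filter, Finset.mem_univ, true_and, Finset.mem_inter] at hab ⊢
      exact ⟨⟨hab.1, hCA hab.2.1, hCA hab.2.2⟩, ⟨hab.1, hCB hab.2.1, hCB hab.2.2⟩⟩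
  refine ⟨F1' ∪ F2', htri, ?_, ?_, ?_⟩
  · intro a b hab
    rw [Finset.filter_union]
    refine (Finset.card_union_le _ _).trans ?_
    have u1 := (Finset.card_le_card (Finset.filter_subset_filter (fun T => a ∈ T ∧ b ∈ T) hF1)).trans
      (h1.2.1 a b hab)
    have u2 := (Finset.card_le_card (Finset.filter_subset_filter (fun T => a ∈ T ∧ b ∈ T) hF2)).trans
      (h2.2.1 a b hab)
    rcases (F1'.filter fun T => a ∈ T ∧ b ∈ T).eq_empty_or_nonempty with e1 | ⟨T1, hT1⟩
    · rw [e1]; simpa using u2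
    rcases (F2'.filter fun T => a ∈ T ∧ b ∈ T).eq_empty_or_nonempty with e2 | ⟨T2, hT2⟩
    · rw [e2]; simpa using u1
    rw [Finset.mem_filter] at hT1 hT2
    have haC : a ∈ C := hAB a (hF1A T1 (hF1 hT1.1) hT1.2.1) (hF2B T2 (hF2 hT2.1) hT2.2.1)
    have hbC : b ∈ C := hAB b (hF1A T1 (hF1 hT1.1) hT1.2.2) (hF2B T2 (hF2 hT2.1) hT2.2.2)
    have := hx1 a haC b hbC hab
    have := hx2 a haC b hbC hab
    omega
  · rw [Finset.card_union_of_disjoint hdis]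
    have := h1.2.2.1
    have := h2.2.2.1
    omega
  · intro Q hQ hsub
    exfalso
    have hQc : Tri G Q := four_clique hQ (fun T hT => (htri T hT).2) hsub
    have hQS : Q ⊆ S := by
      intro x hx
      obtain ⟨T, hT, hxT⟩ := four_ex1 hQ hx
      exact Tri.subset hs (htri T (hsub hT)).1 (htri T (hsub hT)).2 hxT
    have hor : Q ⊆ A ∨ Q ⊆ B := by
      by_cases hQD : ∃ d ∈ Q, d ∈ D
      · left
        obtain ⟨d, hdQ, hdD⟩ := hQD
        intro q hq
        by_cases hqC : q ∈ C
        · exact hCA hqC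
        by_cases hqd : q = d
        · subst hqd; simp [hA, hdD]
        · simp only [hA, Finset.mem_union]
          exact Or.inl (hcl d hdD q (by simp [hQS hq, hqC]) (hQc d hdQ q hq (Ne.symm hqd)))
      · right
        intro q hq
        rw [hB, Finset.mem_sdiff]
        exact ⟨hQS hq, fun h => hQD ⟨q, hq, h⟩⟩
    rcases hor with hQA | hQB
    · apply hq1 Q hQ
      intro T hT
      rcases Finset.mem_union.1 (hsub hT) with h | h
      · exact h
      · rw [Finset.mem_powersetCard] at hT
        exact (hside T hT.2.ge (hT.1.trans hQA) (hF2B T (hF2 h))).elim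
    · apply hq2 Q hQ
      intro T hT
      rcases Finset.mem_union.1 (hsub hT) with h | h
      · rw [Finset.mem_powersetCard] at hT
        exact (hside T hT.2.ge (hF1A T (hF1 h)) (hT.1.trans hQB)).elim
      · exact h

end Faces

section FacesMain
open Classical
variable {V : Type} {G : SimpleGraph V}

theorem p2_del [Fintype V] {S : Finset V} (hs : Supp G S) (v : V) :
    p2 G ≤ p2 (restr G (S.erase v)) + 2 * (Finset.univ.filter fun w => G.Adj v w).card := by
  set N := Finset.univ.filter fun w => G.Adj v w with hN
  set E' := Finset.univ.filter fun p : V × V => (restr G (S.erase v)).Adj p.1 p.2 with hE'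
  have h1 : p2 G ≤ (E' ∪ ((N.image fun a => (v, a)) ∪ (N.image fun a => (a, v)))).card := by
    apply Finset.card_le_card
    rintro ⟨a, b⟩ hab
    simp only [Finset.mem_filter, Finset.mem_univ, true_and] at hab
    simp only [Finset.mem_union, hE', Finset.mem_filter, Finset.mem_univ, true_and,
      Finset.mem_image, hN]
    by_cases hav : a = v
    · subst hav
      exact Or.inr (Or.inl ⟨b, hab, rfl⟩)
    · by_cases hbv : b = v
      · subst hbv
        exact Or.inr (Or.inr ⟨a, hab.symm, rfl⟩)
      · exact Or.inl ⟨hab, by simp [hav, hs _ _ hab], by simp [hbv, hs _ _ hab.symm]⟩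
  have h2 := Finset.card_union_le E' ((N.image fun a => (v, a)) ∪ (N.image fun a => (a, v)))
  have h3 := Finset.card_union_le (N.image fun a => (v, a)) (N.image fun a => (a, v))
  have h4 : (N.image fun a => (v, a)).card ≤ N.card := Finset.card_image_le
  have h5 : (N.image fun a => (a, v)).card ≤ N.card := Finset.card_image_le
  show p2 G ≤ E'.card + 2 * N.card
  omega

theorem faces_low [Fintype V] {S : Finset V} (hs : Supp G S) (h5 : 5 ≤ S.card) {v : V} (hv : v ∈ S)
    (hN : (Finset.univ.filter fun w => G.Adj v w).card ≤ 2) {F : Finset (Finset V)}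
    (h : FaceSys (restr G (S.erase v)) (S.erase v) F) : ∃ F, FaceSys G S F := by
  have hp := p2_del hs v
  have hcard : (S.erase v).card + 1 = S.card := Finset.card_erase_add_one hv
  have h3 := h.2.2.1
  have htri : ∀ T ∈ F, T.card = 3 ∧ Tri G T := fun T hT => ⟨(h.1 T hT).1, (h.1 T hT).2.of_restr⟩
  have hFS : ∀ T ∈ F, T ⊆ S.erase v :=
    fun T hT => Tri.subset (supp_restr _) (h.1 T hT).1 (h.1 T hT).2
  by_cases hQ : ∃ Q : Finset V, Q.card = 4 ∧ Q.powersetCard 3 ⊆ F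
  · obtain ⟨Q, hQ4, hQF⟩ := hQ
    have hS4 := h.2.2.2 Q hQ4 hQF
    have hQS := four_eq hQ4 hS4 hFS hQF
    have hQc : Tri G Q := four_clique hQ4 (fun T hT => (htri T hT).2) hQF
    have hF4 : 4 ≤ F.card := by
      have := Finset.card_le_card hQF
      rw [Finset.card_powersetCard, hQ4] at this
      simpa [Nat.choose] using this
    have hp' := p2_le (supp_restr (G := G) (S.erase v))
    rw [hS4] at hp'
    have hvQ : v ∉ Q := by rw [hQS]; simp
    -- erasing a face destroys the only full tetrahedron
    have hera : ∀ T0 ∈ Q.powersetCard 3, ∀ Q' : Finset V, Q'.card = 4 →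
        ¬ Q'.powersetCard 3 ⊆ F.erase T0 := by
      intro T0 hT0 Q' hQ' hsub
      have e := four_eq hQ' hS4 hFS (hsub.trans (Finset.erase_subset _ _))
      rw [e, ← hQS] at hsub
      have := hsub hT0
      simp at this
    rcases Nat.lt_or_ge (Finset.univ.filter fun w => G.Adj v w).card 2 with hlt | hge
    · obtain ⟨x, hx⟩ : Q.Nonempty := by rw [← Finset.card_pos]; omega
      obtain ⟨T0, hT0, -⟩ := four_ex1 hQ4 hx
      refine ⟨F.erase T0, ?_, ?_, ?_, ?_⟩
      · intro T hT
        exact htri T (Finset.mem_of_mem_erase hT)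
      · intro a b hab
        exact (Finset.card_le_card (Finset.filter_subset_filter _ (Finset.erase_subset _ _))).trans
          (h.2.1 a b hab)
      · rw [Finset.card_erase_of_mem (hQF hT0)]
        omega
      · intro Q' hQ' hsub
        exact (hera T0 hT0 Q' hQ' hsub).elim
    · obtain ⟨p, q, hpq, hNe⟩ := Finset.card_eq_two.1 (le_antisymm hN hge)
      have hvp : G.Adj v p := by
        have : p ∈ Finset.univ.filter fun w => G.Adj v w := by rw [hNe]; simp
        simpa using this
      have hvq : G.Adj v q := by
        have : q ∈ Finset.univ.filter fun w => G.Adj v w := by rw [hNe]; simp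
        simpa using this
      have hpQ : p ∈ Q := by rw [hQS]; simp [hvp.ne', hs _ _ hvp.symm]
      have hqQ : q ∈ Q := by rw [hQS]; simp [hvq.ne', hs _ _ hvq.symm]
      have Gpq := hQc p hpQ q hqQ hpq
      obtain ⟨T0, hT0, hpT0, hqT0⟩ := four_ex hQ4 hpQ hqQ hpq
      have hvF : ∀ T ∈ F, v ∉ T := by
        intro T hT hvT
        have := hFS T hT hvT
        simp at this
      have hnew : {v, p, q} ∉ F.erase T0 := fun hh =>
        hvF _ (Finset.mem_of_mem_erase hh) (by simp)
      refine ⟨insert {v, p, q} (F.erase T0), ?_, ?_, ?_, ?_⟩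
      · intro T hT
        rw [Finset.mem_insert] at hT
        rcases hT with rfl | hT
        · refine ⟨?_, ?_⟩
          · rw [Finset.card_eq_three]
            exact ⟨v, p, q, hvp.ne, hvq.ne, hpq, rfl⟩
          · intro a ha b hb hab
            simp at ha hb
            rcases ha with rfl | rfl | rfl <;> rcases hb with rfl | rfl | rfl <;>
              first
              | exact absurd rfl hab
              | assumption
              | (apply SimpleGraph.Adj.symm; assumption)
        · exact htri T (Finset.mem_of_mem_erase hT)
      · intro a b hab
        have e0 := h.2.1 a b hab
        have e1 : ((F.erase T0).filter fun T => a ∈ T ∧ b ∈ T).card ≤ 2 :=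
          (Finset.card_le_card (Finset.filter_subset_filter _ (Finset.erase_subset _ _))).trans e0
        rw [Finset.filter_insert]
        split_ifs with hm
        · refine (Finset.card_insert_le _ _).trans ?_
          by_cases hav : a = v ∨ b = v
          · rw [Finset.filter_false_of_mem]
            · simp
            · intro T hT hh
              have := hvF T (Finset.mem_of_mem_erase hT)
              rcases hav with rfl | rfl
              · exact this hh.1
              · exact this hh.2
          · have hT0m : T0 ∈ F.filter fun T => a ∈ T ∧ b ∈ T := by
              rw [Finset.mem_filter]
              simp only [Finset.mem_insert, Finset.mem_singleton] at hm
              refine ⟨hQF hT0, ?_, ?_⟩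
              · rcases hm.1 with hh | rfl | rfl
                · exact absurd (Or.inl hh) hav
                · exact hpT0
                · exact hqT0
              · rcases hm.2 with hh | rfl | rfl
                · exact absurd (Or.inr hh) hav
                · exact hpT0
                · exact hqT0
            have e : ((F.erase T0).filter fun T => a ∈ T ∧ b ∈ T) =
                (F.filter fun T => a ∈ T ∧ b ∈ T).erase T0 := by
              ext T; simp; tauto
            rw [e, Finset.card_erase_of_mem hT0m]
            omega
        · exact e1
      · rw [Finset.card_insert_of_notMem hnew, Finset.card_erase_of_mem (hQF hT0)]
        omega
      · intro Q' hQ' hsub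
        exfalso
        by_cases hvQ' : v ∈ Q'
        · obtain ⟨w, hw, hwv⟩ := Finset.exists_mem_ne (by omega : 1 < Q'.card) v
          have h1 := four_ge hQ' hvQ' hw hwv.symm
          have h2 : (Q'.powersetCard 3).filter (fun T => v ∈ T ∧ w ∈ T) ⊆ {{v, p, q}} := by
            intro T hT
            rw [Finset.mem_filter] at hT
            rcases Finset.mem_insert.1 (hsub hT.1) with hh | hh
            · simp [hh]
            · exact absurd hT.2.1 (hvF T (Finset.mem_of_mem_erase hh))
          have h3 := Finset.card_le_card h2
          simp only [Finset.card_singleton] at h3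
          omega
        · apply hera T0 hT0 Q' hQ'
          intro T hT
          rcases Finset.mem_insert.1 (hsub hT) with hh | hh
          · rw [Finset.mem_powersetCard] at hT
            exact absurd (hT.1 (by rw [hh]; simp)) hvQ'
          · exact hh
  · exact ⟨F, htri, h.2.1, by omega, fun Q h1 h2 => (hQ ⟨Q, h1, h2⟩).elim⟩

theorem faces_aux [Fintype V] : ∀ k : ℕ, ∀ (G : SimpleGraph V) (S : Finset V), S.card = k →
    G.IsPlanar → Supp G S → 4 ≤ S.card → ∃ F, FaceSys G S F := by
  intro k
  induction k using Nat.strong_induction_on with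
  | _ k ih =>
  intro G S hk hP hs h4
  rcases Nat.lt_or_ge S.card 5 with h5 | h5
  · exact faces_four hs (by omega)
  by_cases hlow : ∃ v ∈ S, (Finset.univ.filter fun w => G.Adj v w).card ≤ 2
  · obtain ⟨v, hv, hN⟩ := hlow
    have hcard : (S.erase v).card + 1 = S.card := Finset.card_erase_add_one hv
    obtain ⟨F, hF⟩ := ih _ (by omega) (restr G (S.erase v)) (S.erase v) rfl
      (planar_mono (restr_le _) hP) (supp_restr _) (by omega)
    exact faces_low hs h5 hv hN hF
  by_cases htc : TC G S
  · exact faces_tc hP hs htc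
  have hdeg : ∀ v ∈ S, 3 ≤ (Finset.univ.filter fun w => G.Adj v w).card := by
    intro v hv
    by_contra hcon
    exact hlow ⟨v, hv, by omega⟩
  have hn2 : ∃ C : Finset V, C.card ≤ 2 ∧ ¬ Conn G (S \ C) := by
    by_contra hcon
    push Not at hcon
    exact htc ⟨by omega, hcon⟩
  obtain ⟨C0, hC0, hnc0⟩ := hn2
  obtain ⟨C, hCS, hC, hnc⟩ : ∃ C ⊆ S, C.card ≤ 2 ∧ ¬ Conn G (S \ C) :=
    ⟨S ∩ C0, Finset.inter_subset_left, (Finset.card_le_card Finset.inter_subset_right).trans hC0,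
      by rwa [Finset.sdiff_inter_self_left]⟩
  have hne : (S \ C).Nonempty := by
    rw [← Finset.card_pos]
    have := Finset.le_card_sdiff C S
    omega
  have hD : ∃ D ⊆ S \ C, D.Nonempty ∧
      (∀ p ∈ D, ∀ q ∈ S \ C, G.Adj p q → q ∈ D) ∧ ∃ o ∈ S \ C, o ∉ D := by
    by_contra hcon
    apply hnc
    refine ⟨hne, fun D hD hDne hcl => ?_⟩
    intro o ho
    by_contra hoD
    exact hcon ⟨D, hD, hDne, hcl, o, ho, hoD⟩
  obtain ⟨D, hD, ⟨d, hd⟩, hcl, o, ho, hoD⟩ := hD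
  have hoS := Finset.mem_sdiff.1 ho
  have hdS := Finset.mem_sdiff.1 (hD hd)
  have hA4 : 4 ≤ (D ∪ C).card := by
    have h1 := hdeg d hdS.1
    have h2 : insert d (Finset.univ.filter fun w => G.Adj d w) ⊆ D ∪ C := by
      intro w hw
      simp only [Finset.mem_insert, Finset.mem_filter, Finset.mem_univ, true_and] at hw
      rw [Finset.mem_union]
      rcases hw with rfl | hw
      · exact Or.inl hd
      · by_cases hwC : w ∈ C
        · exact Or.inr hwC
        · exact Or.inl (hcl d hd w (by simp [hwC, hs _ _ hw.symm]) hw)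
    have h3 := Finset.card_le_card h2
    rw [Finset.card_insert_of_notMem (by simp)] at h3
    omega
  have hB4 : 4 ≤ (S \ D).card := by
    have h1 := hdeg o hoS.1
    have h2 : insert o (Finset.univ.filter fun w => G.Adj o w) ⊆ S \ D := by
      intro w hw
      simp only [Finset.mem_insert, Finset.mem_filter, Finset.mem_univ, true_and] at hw
      rw [Finset.mem_sdiff]
      rcases hw with rfl | hw
      · exact ⟨hoS.1, hoD⟩
      · exact ⟨hs _ _ hw.symm, fun hwD => hoD (hcl w hwD o ho hw.symm)⟩
    have h3 := Finset.card_le_card h2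
    rw [Finset.card_insert_of_notMem (by simp)] at h3
    omega
  have hAlt : (D ∪ C).card < S.card := by
    apply Finset.card_lt_card
    refine ⟨Finset.union_subset (fun v hv => (Finset.mem_sdiff.1 (hD hv)).1) hCS, fun hh => ?_⟩
    have := hh hoS.1
    rw [Finset.mem_union] at this
    tauto
  have hBlt : (S \ D).card < S.card := by
    apply Finset.card_lt_card
    refine ⟨Finset.sdiff_subset, fun hh => ?_⟩
    have := hh hdS.1
    rw [Finset.mem_sdiff] at this
    tauto
  obtain ⟨F1, hF1⟩ := ih _ (by omega) (restr G (D ∪ C)) (D ∪ C) rfl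
    (planar_mono (restr_le _) hP) (supp_restr _) hA4
  obtain ⟨F2, hF2⟩ := ih _ (by omega) (restr G (S \ D)) (S \ D) rfl
    (planar_mono (restr_le _) hP) (supp_restr _) hB4
  exact faces_glue hs hCS hC hD hcl hF1 hF2

/-- every planar graph has a face system -/
theorem faces [Fintype V] (hP : G.IsPlanar) (h4 : 4 ≤ Fintype.card V) :
    ∃ F, FaceSys G (Finset.univ : Finset V) F :=
  faces_aux _ G Finset.univ rfl hP (fun _ _ _ => Finset.mem_univ _) h4

end FacesMain

/-- a five-cycle -/
def Cyc5 {V : Type} (G : SimpleGraph V) (a b c d e : V) : Prop :=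
  G.Adj a b ∧ G.Adj b c ∧ G.Adj c d ∧ G.Adj d e ∧ G.Adj e a ∧
    a ≠ c ∧ a ≠ d ∧ b ≠ d ∧ b ≠ e ∧ c ≠ e

/-- every five-cycle passes through `h` -/
def Hub5 {V : Type} (G : SimpleGraph V) (h : V) : Prop :=
  ∀ a b c d e, Cyc5 G a b c d e → h = a ∨ h = b ∨ h = c ∨ h = d ∨ h = e

/-- the local situation of triangular faces around two hubs -/
structure Core {V : Type} (G : SimpleGraph V) (t : V → V → V → Prop) (h k : V) : Prop where
  s1 : ∀ a b c, t a b c → t b a c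
  s2 : ∀ a b c, t a b c → t a c b
  adj : ∀ a b c, t a b c → G.Adj a b
  nohub : ∀ c, ¬ t h k c
  three : ∀ a b x y z, t a b x → t a b y → t a b z → x = y ∨ y = z ∨ x = z
  k4 : ∀ a b c d, a ≠ d → b ≠ d → c ≠ d → t a b c → t a b d → t a c d → t b c d → False
  hh : Hub5 G h
  hk : Hub5 G k
  hne : h ≠ k

section CoreLemmas
variable {V : Type} {G : SimpleGraph V} {t : V → V → V → Prop} {h k : V}

theorem Core.swap (C : Core G t h k) : Core G t k h :=
  ⟨C.s1, C.s2, C.adj, fun c hc => C.nohub c (C.s1 _ _ _ hc), C.three, C.k4, C.hk, C.hh, C.hne.symm⟩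

theorem Core.r (C : Core G t h k) {a b c : V} (H : t a b c) : t b c a := C.s2 _ _ _ (C.s1 _ _ _ H)
theorem Core.r2 (C : Core G t h k) {a b c : V} (H : t a b c) : t c a b := C.s1 _ _ _ (C.s2 _ _ _ H)

theorem Core.adjs (C : Core G t h k) {a b c : V} (H : t a b c) :
    G.Adj a b ∧ G.Adj b c ∧ G.Adj c a :=
  ⟨C.adj _ _ _ H, C.adj _ _ _ (C.r H), C.adj _ _ _ (C.r2 H)⟩

/-- uniqueness of the face at the edge `yb` -/
theorem Core.uniq1 (C : Core G t h k) {x y a b c : V} (hxy : (x = h ∧ y = k) ∨ (x = k ∧ y = h))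
    (abc : t a b c) (xab : t x a b) (xca : t x c a) (ybc : t y b c)
    (ha : a ≠ h ∧ a ≠ k) (hb : b ≠ h ∧ b ≠ k) (hc : c ≠ h ∧ c ≠ k) :
    ∀ w, t y b w → w = c := by
  intro w hw
  by_contra hwc
  have A1 := C.adjs abc
  have A2 := C.adjs xab
  have A3 := C.adjs ybc
  have A4 := C.adjs hw
  have hwx : w ≠ x := by
    rintro rfl
    have h1 := C.r2 hw
    rcases hxy with ⟨rfl, rfl⟩ | ⟨rfl, rfl⟩
    · exact C.nohub _ h1
    · exact C.swap.nohub _ h1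
  by_cases hwa : w = a
  · subst hwa
    rcases C.three w b c x y abc (C.r xab) (C.s1 _ _ _ (C.r hw)) with e | e | e
    · subst e; rcases hxy with ⟨e1, _⟩ | ⟨e1, _⟩ <;> tauto
    · subst e; have := C.hne; rcases hxy with ⟨e1, e2⟩ | ⟨e1, e2⟩ <;> subst e1 <;> tauto
    · subst e; rcases hxy with ⟨_, e1⟩ | ⟨_, e1⟩ <;> tauto
  · have hya : y ≠ a := by rcases hxy with ⟨_, e1⟩ | ⟨_, e1⟩ <;> subst e1 <;> tauto
    have hyx : x ≠ y := by have := C.hne; rcases hxy with ⟨e1, e2⟩ | ⟨e1, e2⟩ <;> subst e1 <;> subst e2 <;> tauto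
    have cyc : Cyc5 G y w b a c := ⟨A4.2.2.symm, A4.2.1.symm, A1.1.symm, A1.2.2.symm, A3.2.2,
      A3.1.ne, hya, hwa, hwc, A1.2.1.ne⟩
    have hx : x = h ∨ x = k := by tauto
    have : x = y ∨ x = w ∨ x = b ∨ x = a ∨ x = c := by
      rcases hx with rfl | rfl
      · exact C.hh _ _ _ _ _ cyc
      · exact C.hk _ _ _ _ _ cyc
    have := A2.1.ne
    have := A2.2.2.ne
    have := (C.adjs xca).1.ne
    tauto

/-- the conclusion of the charging argument at a bad face -/
def Comp (t : V → V → V → Prop) (h k a b c : V) : Prop :=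
  ∃ y p q r, (y = h ∨ y = k) ∧ t p q r ∧ t y p q ∧ p ≠ h ∧ p ≠ k ∧ q ≠ h ∧ q ≠ k ∧ y ≠ r ∧
    ((p = a ∧ q = b ∧ r = c) ∨ (p = b ∧ q = c ∧ r = a) ∨ (p = c ∧ q = a ∧ r = b)) ∧
    (∀ w, t y p w → w = q) ∧ (∀ w, t y q w → w = p)

theorem Core.case1_aux (C : Core G t h k) {x y a b c : V} (hxy : (x = h ∧ y = k) ∨ (x = k ∧ y = h))
    (abc : t a b c) (xab : t x a b) (xca : t x c a) (ybc : t y b c)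
    (ha : a ≠ h ∧ a ≠ k) (hb : b ≠ h ∧ b ≠ k) (hc : c ≠ h ∧ c ≠ k) :
    Comp t h k a b c := by
  refine ⟨y, b, c, a, by tauto, C.r abc, ybc, hb.1, hb.2, hc.1, hc.2, ?_, by tauto, 
    C.uniq1 hxy abc xab xca ybc ha hb hc,
    C.uniq1 hxy (C.s2 _ _ _ abc) (C.s2 _ _ _ xca) (C.s2 _ _ _ xab) (C.s2 _ _ _ ybc) ha hc hb⟩
  rcases hxy with ⟨_, e⟩ | ⟨_, e⟩ <;> subst e <;> tauto

theorem Comp.rot {a b c : V} (H : Comp t h k b c a) : Comp t h k a b c := by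
  obtain ⟨y, p, q, r, h1, h2, h3, h4, h5, h6, h7, h8, h9, h10⟩ := H
  exact ⟨y, p, q, r, h1, h2, h3, h4, h5, h6, h7, h8, by tauto, h10⟩

theorem Core.diff (C : Core G t h k) {x y a b c : V}
    (abc : t a b c) (xab : t x a b) (ybc : t y b c) (hxc : x ≠ c) (hya : y ≠ a)
    (ha : a ≠ h ∧ a ≠ k) (hb : b ≠ h ∧ b ≠ k) (hc : c ≠ h ∧ c ≠ k) :
    x = y ∨ (x = h ∧ y = k) ∨ (x = k ∧ y = h) := by
  by_cases hxy : x = y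
  · exact Or.inl hxy
  have A1 := C.adjs abc
  have A2 := C.adjs xab
  have A3 := C.adjs ybc
  have cyc : Cyc5 G a x b y c := ⟨A2.1.symm, A2.2.2.symm, A3.1.symm, A3.2.2.symm, A1.2.2,
    A1.1.ne, Ne.symm hya, hxy, hxc, A1.2.1.ne⟩
  have h1 := C.hh _ _ _ _ _ cyc
  have h2 := C.hk _ _ _ _ _ cyc
  have := C.hne
  right
  rcases h1 with e | e | e | e | e
  · exact absurd e.symm ha.1
  · rcases h2 with f | f | f | f | f
    · exact absurd f.symm ha.2
    · exact absurd (e.trans f.symm) C.hne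
    · exact absurd f.symm hb.2
    · exact Or.inl ⟨e.symm, f.symm⟩
    · exact absurd f.symm hc.2
  · exact absurd e.symm hb.1
  · rcases h2 with f | f | f | f | f
    · exact absurd f.symm ha.2
    · exact Or.inr ⟨f.symm, e.symm⟩
    · exact absurd f.symm hb.2
    · exact absurd (e.trans f.symm) C.hne
    · exact absurd f.symm hc.2
  · exact absurd e.symm hc.1

theorem Core.case1 (C : Core G t h k) {x y z a b c : V}
    (abc : t a b c) (xab : t x a b) (ybc : t y b c) (zca : t z c a)
    (hxc : x ≠ c) (hya : y ≠ a) (hzb : z ≠ b)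
    (ha : a ≠ h ∧ a ≠ k) (hb : b ≠ h ∧ b ≠ k) (hc : c ≠ h ∧ c ≠ k) :
    Comp t h k a b c := by
  have d1 := C.diff abc xab ybc hxc hya ha hb hc
  have d2 := C.diff (C.r abc) ybc zca hya hzb hb hc ha
  have d3 := C.diff (C.r2 abc) zca xab hzb hxc hc ha hb
  have hne := C.hne
  by_cases hxy : x = y
  · by_cases hxz : x = z
    · exfalso
      subst hxy; subst hxz
      exact C.k4 a b c x (C.adjs xab).1.ne' (C.adjs xab).2.2.ne (Ne.symm hxc) abc (C.r xab)
        (C.s1 _ _ _ (C.r zca)) (C.r ybc)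
    · -- `z` is different, across `ca`
      subst hxy
      have e : (x = h ∧ z = k) ∨ (x = k ∧ z = h) := by tauto
      have := C.case1_aux e (C.r abc) ybc xab zca hb hc ha
      exact this.rot
  · have e : (x = h ∧ y = k) ∨ (x = k ∧ y = h) := by tauto
    by_cases hxz : x = z
    · subst hxz
      exact C.case1_aux e abc xab zca ybc ha hb hc
    · have hyz : y = z := by
        rcases e with ⟨e1, e2⟩ | ⟨e1, e2⟩ <;> rcases d3 with d | ⟨d4, d5⟩ | ⟨d4, d5⟩
        · exact absurd d.symm hxz
        · exact absurd (d5.symm.trans e1) hne.symm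
        · rw [e2, d4]
        · exact absurd d.symm hxz
        · rw [e2, d4]
        · exact absurd (d5.symm.trans e1) hne
      subst hyz
      have := C.case1_aux (x := y) (y := x) (by tauto) (C.r2 abc) zca ybc xab hc ha hb
      exact this.rot.rot

/-- faces at a hub -/
theorem Core.case2 (C : Core G t h k) {x y z a b : V}
    (hab : t h a b) (hay : t h a y) (hbz : t h b z) (xab : t x a b)
    (hyb : y ≠ b) (hza : z ≠ a) (hxh : x ≠ h) (ha : a ≠ k) (hb : b ≠ k) :
    Comp t h k h a b ∨ (G.Adj a b ∧ G.Adj a y ∧ G.Adj b y ∧ G.Adj h a ∧ G.Adj h b ∧ G.Adj h y ∧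
      G.Adj k a ∧ G.Adj k b ∧ G.Adj k y) := by
  have A1 := C.adjs hab
  have A2 := C.adjs hay
  have A3 := C.adjs hbz
  have A4 := C.adjs xab
  have hyk : y ≠ k := by rintro rfl; exact C.nohub _ (C.s2 _ _ _ hay)
  have hzk : z ≠ k := by rintro rfl; exact C.nohub _ (C.s2 _ _ _ hbz)
  have hyz : y = z := by
    by_contra hyz
    have h9 := C.hk h y a b z ⟨A2.2.2.symm, A2.2.1.symm, A1.2.1, A3.2.1, A3.2.2, A1.1.ne,
      A1.2.2.ne', hyb, hyz, Ne.symm hza⟩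
    have := C.hne
    rcases h9 with e | e | e | e | e
    all_goals tauto
  subst hyz
  have hxy : x ≠ y := by
    rintro rfl
    exact C.k4 h a b x (Ne.symm hxh) A2.2.1.ne A3.2.1.ne hab hay hbz (C.r xab)
  have hxk : x = k := by
    by_contra hxk
    have := C.hk h y a x b ⟨A2.2.2.symm, A2.2.1.symm, A4.1.symm, A4.2.2.symm, A1.2.2, A1.1.ne,
      Ne.symm hxh, Ne.symm hxy, hyb, A1.2.1.ne⟩
    have := C.hne
    tauto
  subst hxk
  by_cases hex : t x a y ∨ t x b y
  · right
    have : G.Adj x y := by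
      rcases hex with e | e
      · exact (C.adjs e).2.2.symm
      · exact (C.adjs e).2.2.symm
    exact ⟨A1.2.1, A2.2.1, A3.2.1, A1.1, A1.2.2.symm, A2.2.2.symm, A4.1, A4.2.2.symm, this⟩
  · left
    push Not at hex
    refine ⟨x, a, b, h, Or.inr rfl, C.r hab, xab, A1.1.ne', ha, A1.2.2.ne, hb, hxh, by tauto, ?_, ?_⟩
    · intro w hw
      by_contra hwb
      have A5 := C.adjs hw
      have hwh : w ≠ h := by rintro rfl; exact C.nohub _ (C.r2 hw)
      have hwy : w ≠ y := by rintro rfl; exact hex.1 hw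
      have := C.hh x w a y b ⟨A5.2.2.symm, A5.2.1.symm, A2.2.1, A3.2.1.symm, A4.2.2, A4.1.ne,
        hxy, hwy, hwb, A1.2.1.ne⟩
      have := A1.1.ne
      have := A1.2.2.ne
      have := A2.2.2.ne
      tauto
    · intro w hw
      by_contra hwb
      have A5 := C.adjs hw
      have hwh : w ≠ h := by rintro rfl; exact C.nohub _ (C.r2 hw)
      have hwy : w ≠ y := by rintro rfl; exact hex.2 hw
      have := C.hh x w b y a ⟨A5.2.2.symm, A5.2.1.symm, A3.2.1, A2.2.1.symm, A4.1.symm,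
        A4.2.2.ne', hxy, hwy, hwb, A1.2.1.ne'⟩
      have := A1.1.ne
      have := A1.2.2.ne
      have := A2.2.2.ne
      tauto

end CoreLemmas

section HubCount
open Classical
variable {V : Type} {G : SimpleGraph V}

/-- exceptional faces -/
def Exc (G : SimpleGraph V) (u v : V) (f : Finset V) : Prop :=
  ∃ h a b y, (h = u ∨ h = v) ∧ f = {h, a, b} ∧ G.Adj a b ∧ G.Adj a y ∧ G.Adj b y ∧
    G.Adj u a ∧ G.Adj u b ∧ G.Adj u y ∧ G.Adj v a ∧ G.Adj v b ∧ G.Adj v y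

theorem k5_pairs {u v a b y w : V} (hP : G.IsPlanar) (huv : u ≠ v) (hwu : w = u ∨ G.Adj u w)
    (hwv : G.Adj v w) (hwa : w ≠ a) (hwb : w ≠ b) (hwy : w ≠ y)
    (h1 : G.Adj a b) (h2 : G.Adj a y) (h3 : G.Adj b y)
    (h4 : G.Adj u a) (h5 : G.Adj u b) (h6 : G.Adj u y)
    (h7 : G.Adj v a) (h8 : G.Adj v b) (h9 : G.Adj v y) : False := by
  have hc : Conn G {u, w} := by
    rcases hwu with rfl | h
    · simpa using conn_singleton (G := G) w
    · exact conn_pair h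
  refine noK5 hP (A := {u, w}) (B := {v}) (C := {a}) (D := {b}) (E := {y}) ?_ ?_ ?_
  · intro X hX
    simp only [List.mem_cons, List.not_mem_nil, or_false] at hX
    rcases hX with rfl | rfl | rfl | rfl | rfl
    · exact hc
    all_goals exact conn_singleton _
  · simp [huv, hwv.ne', hwa, hwb, hwy, h1.ne, h2.ne, h3.ne, h4.ne, h5.ne, h6.ne, h7.ne, h8.ne, h9.ne]
  · simp [Touch, h1, h2, h3, h4, h5, h6, h7, h8, h9, hwv.symm]

theorem exc_card [Fintype V] {u v : V} (hP : G.IsPlanar) (huv : u ≠ v) {X : Finset (Finset V)}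
    (hX : ∀ f ∈ X, Exc G u v f) : X.card ≤ 6 ∧ (G.Adj u v → X.card = 0) := by
  constructor
  · rcases X.eq_empty_or_nonempty with rfl | ⟨f0, hf0⟩
    · simp
    obtain ⟨h, a, b, y, -, -, h1, h2, h3, h4, h5, h6, h7, h8, h9⟩ := hX f0 hf0
    have key : ∀ w, G.Adj u w → G.Adj v w → w ∈ ({a, b, y} : Finset V) := by
      intro w hu hv
      by_contra hw
      simp only [Finset.mem_insert, Finset.mem_singleton, not_or] at hw
      exact k5_pairs hP huv (Or.inr hu) hv hw.1 hw.2.1 hw.2.2 h1 h2 h3 h4 h5 h6 h7 h8 h9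
    have hs : X ⊆ (({u, v} : Finset V) ×ˢ (({a, b, y} : Finset V).powersetCard 2)).image
        fun p => insert p.1 p.2 := by
      intro f hf
      obtain ⟨h', a', b', y', hh, rfl, g1, g2, g3, g4, g5, g6, g7, g8, g9⟩ := hX f hf
      rw [Finset.mem_image]
      refine ⟨(h', {a', b'}), ?_, rfl⟩
      rw [Finset.mem_product, Finset.mem_powersetCard]
      refine ⟨by simpa using hh, ?_, Finset.card_pair g1.ne⟩
      intro w hw
      simp only [Finset.mem_insert, Finset.mem_singleton] at hw
      rcases hw with rfl | rfl
      · exact key _ g4 g7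
      · exact key _ g5 g8
    calc X.card ≤ _ := Finset.card_le_card hs
      _ ≤ _ := Finset.card_image_le
      _ = ({u, v} : Finset V).card * (({a, b, y} : Finset V).card.choose 2) := by
          rw [Finset.card_product, Finset.card_powersetCard]
      _ ≤ 2 * (3 : ℕ).choose 2 := 
          Nat.mul_le_mul Finset.card_le_two (Nat.choose_le_choose 2 Finset.card_le_three)
      _ = 6 := by decide
  · intro hadj
    rw [Finset.card_eq_zero, Finset.eq_empty_iff_forall_notMem]
    intro f hf
    obtain ⟨h, a, b, y, -, -, h1, h2, h3, h4, h5, h6, h7, h8, h9⟩ := hX f hf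
    exact k5_pairs hP huv (Or.inl rfl) hadj.symm h4.ne h5.ne h6.ne h1 h2 h3 h4 h5 h6 h7 h8 h9

theorem charge {α : Type} {T X : Finset α} {c : α → ℕ} (g : α → α)
    (h2 : ∀ f ∈ T, c f ≠ 0 → 2 ≤ c f)
    (hg : ∀ f ∈ T, c f = 0 → f ∉ X → g f ∈ T ∧ 4 ≤ c (g f))
    (hinj : ∀ f ∈ T, ∀ f' ∈ T, c f = 0 → c f' = 0 → f ∉ X → f' ∉ X → g f = g f' → f = f') :
    2 * T.card ≤ (∑ f ∈ T, c f) + 2 * X.card := by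
  have h1 : (∑ f ∈ T, ((if c f ≠ 0 then 2 else 0) + (if 4 ≤ c f then 2 else 0))) ≤ ∑ f ∈ T, c f := by
    apply Finset.sum_le_sum
    intro f hf
    have := h2 f hf
    split_ifs <;> omega
  rw [Finset.sum_add_distrib, ← Finset.sum_filter, ← Finset.sum_filter, Finset.sum_const,
    Finset.sum_const, smul_eq_mul, smul_eq_mul] at h1
  set A := T.filter fun f => c f ≠ 0 with hA
  set B := T.filter fun f => ¬ c f ≠ 0 with hB
  set D := T.filter fun f => 4 ≤ c f with hD
  have e : A.card + B.card = T.card := Finset.card_filter_add_card_filter_not _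
  have h3 : (B \ X).card ≤ D.card := by
    apply Finset.card_le_card_of_injOn g
    · intro f hf
      simp only [hB, Finset.coe_sdiff, Set.mem_sdiff, Finset.mem_coe, Finset.mem_filter, not_not] at hf
      have := hg f hf.1.1 hf.1.2 hf.2
      simp [hD, this]
    · intro f hf f' hf' hff
      simp only [hB, Finset.coe_sdiff, Set.mem_sdiff, Finset.mem_coe, Finset.mem_filter, not_not] at hf hf'
      exact hinj f hf.1.1 f' hf'.1.1 hf.1.2 hf'.1.2 hf.2 hf'.2 hff
  have h4 : B.card ≤ (B \ X).card + X.card := by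
    have := Finset.card_le_card_sdiff_add_card (s := B) (t := X)
    omega
  omega

theorem card3_ne {a b c : V} (h : ({a, b, c} : Finset V).card = 3) : a ≠ b ∧ b ≠ c ∧ a ≠ c := by
  refine ⟨?_, ?_, ?_⟩ <;> rintro rfl
  · rw [Finset.insert_idem] at h; have := Finset.card_le_two (a := a) (b := c); omega
  · have e : ({a, b, b} : Finset V) = {a, b} := by simp
    rw [e] at h; have := Finset.card_le_two (a := a) (b := b); omega
  · have e : ({a, b, a} : Finset V) = {a, b} := by ext; simp; tauto
    rw [e] at h; have := Finset.card_le_two (a := a) (b := b); omega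

theorem core_of {u v : V} {T : Finset (Finset V)}
    (hT : ∀ f ∈ T, f.card = 3 ∧ Tri G f)
    (h2 : ∀ a b, a ≠ b → (T.filter fun f => a ∈ f ∧ b ∈ f).card ≤ 2)
    (huv : u ≠ v) (hTuv : ∀ f ∈ T, ¬ (u ∈ f ∧ v ∈ f))
    (h4 : ∀ Q : Finset V, Q.card = 4 → ¬ Q.powersetCard 3 ⊆ T)
    (hu : Hub5 G u) (hv : Hub5 G v) :
    Core G (fun a b c => ({a, b, c} : Finset V) ∈ T) u v := by
  have hne : ∀ {a b c : V}, ({a, b, c} : Finset V) ∈ T → a ≠ b ∧ b ≠ c ∧ a ≠ c :=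
    fun h => card3_ne (hT _ h).1
  refine ⟨?_, ?_, ?_, ?_, ?_, ?_, hu, hv, huv⟩
  · intro a b c h
    simpa only [Finset.insert_comm a b] using h
  · intro a b c h
    simpa only [Finset.pair_comm b c] using h
  · intro a b c h
    exact (hT _ h).2 a (by simp) b (by simp) (hne h).1
  · intro c h
    exact hTuv _ h ⟨by simp, by simp⟩
  · intro a b x y z hx hy hz
    by_contra hcon
    push Not at hcon
    obtain ⟨n1, n2, n3⟩ := hcon
    have := h2 a b (hne hx).1
    have h3 : 2 < (T.filter fun f => a ∈ f ∧ b ∈ f).card := by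
      have hd : ∀ {x y : V}, x ≠ y → ({a, b, x} : Finset V) ∈ T → ({a, b, x} : Finset V) ≠ {a, b, y} := by
        intro x y hxy hx e
        have h0 : x ∈ ({a, b, y} : Finset V) := by rw [← e]; simp
        have := hne hx
        simp only [Finset.mem_insert, Finset.mem_singleton] at h0
        rcases h0 with e | e | e
        · exact this.2.2 e.symm
        · exact this.2.1 e.symm
        · exact hxy e
      rw [Finset.two_lt_card]
      exact ⟨_, by simp [hx], _, by simp [hy], _, by simp [hz], hd n1 hx, hd n3 hx, hd n2 hy⟩
    omega
  · intro a b c d had hbd hcd abc abd acd bcd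
    have n := hne abc
    apply h4 {a, b, c, d}
    · rw [Finset.card_insert_of_notMem, Finset.card_insert_of_notMem, Finset.card_pair hcd]
      · simp [n.2.1, hbd]
      · simp [n.1, n.2.2, had]
    · intro f hf
      rw [Finset.mem_powersetCard] at hf
      have hq : ({a, b, c, d} : Finset V).card = 4 := by
        rw [Finset.card_insert_of_notMem, Finset.card_insert_of_notMem, Finset.card_pair hcd]
        · simp [n.2.1, hbd]
        · simp [n.1, n.2.2, had]
      have h1 : (({a, b, c, d} : Finset V) \ f).card = 1 := by
        rw [Finset.card_sdiff_of_subset hf.1, hq, hf.2]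
      obtain ⟨z, hz⟩ := Finset.card_eq_one.1 h1
      have hfe : f = ({a, b, c, d} : Finset V).erase z := by
        rw [← Finset.sdiff_singleton_eq_erase, ← hz, Finset.sdiff_sdiff_eq_self hf.1]
      have hzm : z ∈ ({a, b, c, d} : Finset V) := by
        have : z ∈ ({a, b, c, d} : Finset V) \ f := by rw [hz]; simp
        exact (Finset.mem_sdiff.1 this).1
      simp only [Finset.mem_insert, Finset.mem_singleton] at hzm
      obtain ⟨n1, n2, n3⟩ := n
      rcases hzm with rfl | rfl | rfl | rfl
      · convert bcd using 1; rw [hfe]; ext w; simp; grind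
      · convert acd using 1; rw [hfe]; ext w; simp; grind
      · convert abd using 1; rw [hfe]; ext w; simp; grind
      · convert abc using 1; rw [hfe]; ext w; simp; grind

end HubCount

section HubMain
open Classical
variable {V : Type} {G : SimpleGraph V}

theorem hub_T [Fintype V] {u v : V} {T : Finset (Finset V)} {E : Finset (V × V)}
    (hT : ∀ f ∈ T, f.card = 3 ∧ Tri G f)
    (h2 : ∀ a b, a ≠ b → (T.filter fun f => a ∈ f ∧ b ∈ f).card ≤ 2)
    (huv : u ≠ v) (hTuv : ∀ f ∈ T, ¬ (u ∈ f ∧ v ∈ f))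
    (h4 : ∀ Q : Finset V, Q.card = 4 → ¬ Q.powersetCard 3 ⊆ T)
    (hu : Hub5 G u) (hv : Hub5 G v)
    (hE1 : ∀ p ∈ E, p.1 ≠ p.2)
    (hE : ∀ f ∈ T, ∀ a ∈ f, ∀ b ∈ f, a ≠ b → (a, b) ∈ E) :
    ∃ X : Finset (Finset V), (∀ f ∈ X, Exc G u v f) ∧ 4 * T.card ≤ E.card + X.card := by
  have C := core_of hT h2 huv hTuv h4 hu hv
  set m : V × V → ℕ := fun p => (T.filter fun f => p.1 ∈ f ∧ p.2 ∈ f).card with hm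
  set P := E.filter fun p => m p = 1 with hPdef
  set c : Finset V → ℕ := fun f => (P.filter fun p => p.1 ∈ f ∧ p.2 ∈ f).card with hc
  -- double counting
  have dc : ∀ E0 : Finset (V × V), ∑ p ∈ E0, m p =
      ∑ f ∈ T, (E0.filter fun p => p.1 ∈ f ∧ p.2 ∈ f).card := by
    intro E0
    exact Finset.sum_card_bipartiteAbove_eq_sum_card_bipartiteBelow
      (fun (p : V × V) (f : Finset V) => p.1 ∈ f ∧ p.2 ∈ f)
  have s1 : ∑ p ∈ E, m p = 6 * T.card := by
    rw [dc, Finset.sum_congr rfl (g := fun _ => 6), Finset.sum_const, smul_eq_mul, mul_comm]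
    intro f hf
    have : (E.filter fun p => p.1 ∈ f ∧ p.2 ∈ f) = f.offDiag := by
      ext ⟨a, b⟩
      rw [Finset.mem_filter, Finset.mem_offDiag]
      constructor
      · rintro ⟨h, h', h''⟩; exact ⟨h', h'', hE1 _ h⟩
      · rintro ⟨h, h', h''⟩; exact ⟨hE f hf a h b h' h'', h, h'⟩
    rw [this, Finset.offDiag_card, (hT f hf).1]
  have s2 : ∑ f ∈ T, c f = P.card := by
    rw [← dc P, Finset.sum_congr rfl (g := fun _ => 1), Finset.sum_const, smul_eq_mul, mul_one]
    intro p hp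
    exact (Finset.mem_filter.1 hp).2
  have s3 : 6 * T.card + P.card ≤ 2 * E.card := by
    have e1 : P.card = ∑ p ∈ E, if m p = 1 then 1 else 0 := by
      rw [hPdef, Finset.card_filter]
    rw [← s1, e1, ← Finset.sum_add_distrib, mul_comm, ← smul_eq_mul, ← Finset.sum_const]
    apply Finset.sum_le_sum
    intro p hp
    have h' : m p ≤ 2 := h2 p.1 p.2 (hE1 p hp)
    split_ifs <;> omega
  -- single pairs
  have hsym : ∀ a b, (a, b) ∈ P → (b, a) ∈ P := by
    intro a b hab
    rw [hPdef, Finset.mem_filter] at hab ⊢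
    have e : m (b, a) = m (a, b) := by simp only [hm, and_comm]
    refine ⟨?_, by rw [e, hab.2]⟩
    have : 0 < m (a, b) := by omega
    obtain ⟨f, hf⟩ := Finset.card_pos.1 this
    rw [Finset.mem_filter] at hf
    exact hE f hf.1 b hf.2.2 a hf.2.1 (hE1 _ hab.1).symm
  have c2 : ∀ f ∈ T, c f ≠ 0 → 2 ≤ c f := by
    intro f hf h0
    obtain ⟨⟨a, b⟩, hp⟩ := Finset.card_pos.1 (Nat.pos_of_ne_zero h0)
    rw [Finset.mem_filter] at hp
    have hne : a ≠ b := hE1 _ (Finset.mem_filter.1 hp.1).1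
    have : 1 < c f := by
      rw [hc, Finset.one_lt_card]
      refine ⟨(a, b), by simp [hp.1, hp.2.1, hp.2.2], (b, a), ?_, ?_⟩
      · simp [hsym _ _ hp.1, hp.2.1, hp.2.2]
      · intro e; exact hne (congrArg Prod.fst e)
    exact this
  have bad : ∀ a b z, ({a, b, z} : Finset V) ∈ T → c {a, b, z} = 0 →
      ∃ x, x ≠ z ∧ ({a, b, x} : Finset V) ∈ T := by
    intro a b z hf h0
    have hne := card3_ne (hT _ hf).1
    have hab : (a, b) ∉ P := by
      intro h
      have : (a, b) ∈ P.filter fun p => p.1 ∈ ({a, b, z} : Finset V) ∧ p.2 ∈ ({a, b, z} : Finset V) := by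
        simp [h]
      have := Finset.card_pos.2 ⟨_, this⟩
      exact absurd h0 (Nat.pos_iff_ne_zero.1 this)
    have hm1 : m (a, b) ≠ 1 := by
      intro h
      exact hab (Finset.mem_filter.2 ⟨hE _ hf a (by simp) b (by simp) hne.1, h⟩)
    have hm0 : 0 < m (a, b) := Finset.card_pos.2 ⟨{a, b, z}, by simp [hf]⟩
    have hm2 : 1 < (T.filter fun f => a ∈ f ∧ b ∈ f).card := by
      change 1 < m (a, b); omega
    obtain ⟨g, hg, hgne⟩ := Finset.exists_mem_ne hm2 {a, b, z}
    rw [Finset.mem_filter] at hg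
    obtain ⟨x, hx1, hx2, rfl⟩ := third (hT _ hg.1).1 hg.2.1 hg.2.2 hne.1
    exact ⟨x, by rintro rfl; exact hgne rfl, hg.1⟩
  -- the compensating relation
  set R : Finset V → Finset V → Prop := fun f g => g ∈ T ∧ 4 ≤ c g ∧ f ≠ g ∧ g \ {u, v} ⊆ f ∧
    2 ≤ (g \ {u, v}).card with hR
  have comp : ∀ a b z, Comp (fun a b c => ({a, b, c} : Finset V) ∈ T) u v a b z →
      ∃ g, R {a, b, z} g := by
    rintro a b z ⟨y, p, q, r, hy, hf, hg, hp1, hp2, hq1, hq2, hyr, hrot, hs1, hs2⟩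
    have hfe : ({a, b, z} : Finset V) = {p, q, r} := by
      rcases hrot with ⟨rfl, rfl, rfl⟩ | ⟨rfl, rfl, rfl⟩ | ⟨rfl, rfl, rfl⟩
      · rfl
      · ext; simp; tauto
      · ext; simp; tauto
    rw [hfe]
    have hyp : y ≠ p := by rcases hy with rfl | rfl <;> [exact hp1.symm; exact hp2.symm]
    have hyq : y ≠ q := by rcases hy with rfl | rfl <;> [exact hq1.symm; exact hq2.symm]
    have hpq := (card3_ne (hT _ hg).1).2.1
    have single : ∀ p q, y ≠ p → ({y, p, q} : Finset V) ∈ T →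
        (∀ w, ({y, p, w} : Finset V) ∈ T → w = q) → (y, p) ∈ P := by
      intro p q hyp hg hs
      refine Finset.mem_filter.2 ⟨hE _ hg y (by simp) p (by simp) hyp, ?_⟩
      rw [hm]
      refine Finset.card_eq_one.2 ⟨{y, p, q}, ?_⟩
      ext f
      rw [Finset.mem_filter, Finset.mem_singleton]
      constructor
      · rintro ⟨h, h', h''⟩
        obtain ⟨w, -, -, rfl⟩ := third (hT _ h).1 h' h'' hyp
        rw [hs w h]
      · rintro rfl; exact ⟨hg, by simp, by simp⟩
    have hgs : ({y, q, p} : Finset V) = {y, p, q} := by rw [Finset.pair_comm]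
    have P1 := single p q hyp hg hs1
    have P2 := single q p hyq (by rw [hgs]; exact hg) hs2
    have P3 := hsym _ _ P1
    have P4 := hsym _ _ P2
    have hgd : ({y, p, q} : Finset V) \ {u, v} = {p, q} := by
      ext w
      simp only [Finset.mem_sdiff, Finset.mem_insert, Finset.mem_singleton]
      constructor
      · rintro ⟨rfl | h, h'⟩
        · exact absurd hy h'
        · exact h
      · rintro (rfl | rfl)
        · exact ⟨by simp, by tauto⟩
        · exact ⟨by simp, by tauto⟩
    refine ⟨{y, p, q}, hg, ?_, ?_, ?_, ?_⟩
    · have : ({(y, p), (y, q), (p, y), (q, y)} : Finset (V × V)).card = 4 := by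
        rw [Finset.card_insert_of_notMem, Finset.card_insert_of_notMem, Finset.card_pair]
        · simp [hpq]
        · simp [hyp, hyq]
        · simp [hyp, hyq, hpq]
      rw [← this]
      apply Finset.card_le_card
      intro x hx
      simp only [Finset.mem_insert, Finset.mem_singleton] at hx
      rw [Finset.mem_filter]
      rcases hx with rfl | rfl | rfl | rfl
      · exact ⟨P1, by simp, by simp⟩
      · exact ⟨P2, by simp, by simp⟩
      · exact ⟨P3, by simp, by simp⟩
      · exact ⟨P4, by simp, by simp⟩
    · intro e
      have : y ∈ ({p, q, r} : Finset V) := by rw [e]; simp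
      simp only [Finset.mem_insert, Finset.mem_singleton] at this
      tauto
    · rw [hgd]; intro w; simp; tauto
    · rw [hgd, Finset.card_pair hpq]
  -- every bad face is exceptional or compensated
  have main : ∀ f ∈ T, c f = 0 → Exc G u v f ∨ ∃ g, R f g := by
    intro f hf h0
    have rotc : ∀ a b z : V, ({b, z, a} : Finset V) = {a, b, z} := by
      intro a b z; ext; simp; tauto
    by_cases huf : u ∈ f
    · have hvf : v ∉ f := fun h => hTuv f hf ⟨huf, h⟩
      obtain ⟨a, ha, hau⟩ := Finset.exists_mem_ne (by rw [(hT f hf).1]; norm_num : 1 < f.card) u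
      obtain ⟨b, hb1, hb2, rfl⟩ := third (hT f hf).1 huf ha hau.symm
      simp only [Finset.mem_insert, Finset.mem_singleton, not_or] at hvf
      obtain ⟨y, hy, hay⟩ := bad u a b hf h0
      have e1 : ({u, b, a} : Finset V) = {u, a, b} := by rw [Finset.pair_comm]
      obtain ⟨z, hz, hbz⟩ := bad u b a (by rwa [e1]) (by rwa [e1])
      obtain ⟨x, hx, hxab⟩ := bad a b u (by rwa [rotc]) (by rwa [rotc])
      rcases C.case2 hf hay hbz (x := x) (by simpa only [rotc x a b] using hxab) hy hz hx
        (Ne.symm hvf.2.1) (Ne.symm hvf.2.2) with h | h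
      · exact Or.inr (comp _ _ _ h)
      · left
        obtain ⟨h1, h2, h3, h4, h5, h6, h7, h8, h9⟩ := h
        exact ⟨u, a, b, y, Or.inl rfl, rfl, h1, h2, h3, h4, h5, h6, h7, h8, h9⟩
    · by_cases hvf : v ∈ f
      · obtain ⟨a, ha, hau⟩ := Finset.exists_mem_ne (by rw [(hT f hf).1]; norm_num : 1 < f.card) v
        obtain ⟨b, hb1, hb2, rfl⟩ := third (hT f hf).1 hvf ha hau.symm
        simp only [Finset.mem_insert, Finset.mem_singleton, not_or] at huf
        obtain ⟨y, hy, hay⟩ := bad v a b hf h0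
        have e1 : ({v, b, a} : Finset V) = {v, a, b} := by rw [Finset.pair_comm]
        obtain ⟨z, hz, hbz⟩ := bad v b a (by rwa [e1]) (by rwa [e1])
        obtain ⟨x, hx, hxab⟩ := bad a b v (by rwa [rotc]) (by rwa [rotc])
        rcases C.swap.case2 hf hay hbz (x := x) (by simpa only [rotc x a b] using hxab) hy hz hx
          (Ne.symm huf.2.1) (Ne.symm huf.2.2) with h | h
        · right
          apply comp
          obtain ⟨y, p, q, r, hy, hf, hg, hp1, hp2, hq1, hq2, hr⟩ := h
          exact ⟨y, p, q, r, hy.symm, hf, hg, hp2, hp1, hq2, hq1, hr⟩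
        · left
          obtain ⟨h1, h2, h3, h4, h5, h6, h7, h8, h9⟩ := h
          exact ⟨v, a, b, y, Or.inr rfl, rfl, h1, h2, h3, h7, h8, h9, h4, h5, h6⟩
      · right
        obtain ⟨a, b, z, hab, haz, hbz, rfl⟩ := Finset.card_eq_three.1 (hT f hf).1
        simp only [Finset.mem_insert, Finset.mem_singleton, not_or] at huf hvf
        obtain ⟨x, hx, hxab⟩ := bad a b z hf h0
        obtain ⟨y, hy, hybz⟩ := bad b z a (by rwa [rotc]) (by rwa [rotc])
        obtain ⟨w, hw, hwza⟩ := bad z a b (by rwa [rotc, rotc]) (by rwa [rotc, rotc])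
        apply comp
        exact C.case1 (x := x) (y := y) (z := w) hf (by simpa only [rotc x a b] using hxab)
          (by simpa only [rotc y b z] using hybz) (by simpa only [rotc w z a] using hwza) hx hy hw
          ⟨Ne.symm huf.1, Ne.symm hvf.1⟩ ⟨Ne.symm huf.2.1, Ne.symm hvf.2.1⟩
          ⟨Ne.symm huf.2.2, Ne.symm hvf.2.2⟩
  refine ⟨T.filter (Exc G u v), fun f hf => (Finset.mem_filter.1 hf).2, ?_⟩
  set X := T.filter (Exc G u v) with hX
  have hex : ∀ f, ∃ g, (f ∈ T → c f = 0 → f ∉ X → R f g) := by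
    intro f
    by_cases h : f ∈ T ∧ c f = 0 ∧ f ∉ X
    · rcases main f h.1 h.2.1 with h' | ⟨g, hg⟩
      · exact absurd (Finset.mem_filter.2 ⟨h.1, h'⟩) h.2.2
      · exact ⟨g, fun _ _ _ => hg⟩
    · exact ⟨f, fun h1 h2 h3 => absurd ⟨h1, h2, h3⟩ h⟩
  choose g hg using hex
  have := charge (T := T) (X := X) (c := c) g c2
    (fun f h1 h2 h3 => ⟨(hg f h1 h2 h3).1, (hg f h1 h2 h3).2.1⟩) (by
      intro f hf f' hf' h0 h0' hx hx' hgg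
      obtain ⟨r1, r2, r3, r4, r5⟩ := hg f hf h0 hx
      obtain ⟨q1, q2, q3, q4, q5⟩ := hg f' hf' h0' hx'
      rw [← hgg] at q1 q2 q3 q4 q5
      by_contra hff
      obtain ⟨a, ha, b, hb, hab⟩ := Finset.one_lt_card.1 r5
      have h3 := h2 a b hab
      have : 2 < (T.filter fun f => a ∈ f ∧ b ∈ f).card := by
        rw [Finset.two_lt_card]
        exact ⟨f, by simp [hf, r4 ha, r4 hb], f', by simp [hf', q4 ha, q4 hb], g f,
          by simp [r1, (Finset.mem_sdiff.1 ha).1, (Finset.mem_sdiff.1 hb).1], hff, r3, q3⟩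
      omega)
  omega

/-- the two hub bound -/
theorem two_hubs [Fintype V] (hP : G.IsPlanar) {u v : V} (huv : u ≠ v) (hu : Hub5 G u)
    (hv : Hub5 G v) (h5 : 5 ≤ Fintype.card V) : 3 * p2 G + 26 ≤ 16 * Fintype.card V := by
  obtain ⟨F, hF1, hF2, hF3, hF4⟩ := faces hP (by omega : 4 ≤ Fintype.card V)
  rw [Finset.card_univ] at hF3 hF4
  set T := F.filter fun f => ¬ (u ∈ f ∧ v ∈ f) with hT
  set T0 := F.filter fun f => u ∈ f ∧ v ∈ f with hT0
  have e : T0.card + T.card = F.card := Finset.card_filter_add_card_filter_not _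
  set E0 := Finset.univ.filter fun p : V × V => G.Adj p.1 p.2 with hE0
  have hp : p2 G = E0.card := rfl
  set E := E0 \ {(u, v), (v, u)} with hE
  obtain ⟨X, hX, hc⟩ := hub_T (G := G) (u := u) (v := v) (T := T) (E := E)
    (fun f hf => hF1 f (Finset.mem_filter.1 hf).1)
    (fun a b hab => le_trans (Finset.card_le_card (by
      intro f hf
      rw [Finset.mem_filter] at hf ⊢
      exact ⟨(Finset.mem_filter.1 hf.1).1, hf.2⟩)) (hF2 a b hab))
    huv (fun f hf => (Finset.mem_filter.1 hf).2)
    (fun Q hQ hs => by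
      have := hF4 Q hQ (hs.trans (Finset.filter_subset _ _))
      omega) hu hv
    (fun p hp => by
      have := (Finset.mem_filter.1 (Finset.mem_sdiff.1 hp).1).2
      exact this.ne)
    (fun f hf a ha b hb hab => by
      rw [hT, Finset.mem_filter] at hf
      rw [hE, Finset.mem_sdiff, hE0, Finset.mem_filter]
      refine ⟨⟨Finset.mem_univ _, (hF1 f hf.1).2 a ha b hb hab⟩, ?_⟩
      simp only [Finset.mem_insert, Finset.mem_singleton, Prod.mk.injEq, not_or]
      constructor
      · rintro ⟨rfl, rfl⟩; exact hf.2 ⟨ha, hb⟩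
      · rintro ⟨rfl, rfl⟩; exact hf.2 ⟨hb, ha⟩)
  have hx := exc_card hP huv hX
  by_cases hadj : G.Adj u v
  · have h0 := hx.2 hadj
    have h1 : T0.card ≤ 2 := hF2 u v huv
    have h2 : E.card = E0.card - 2 := by
      rw [hE, Finset.card_sdiff_of_subset, Finset.card_pair]
      · intro e; exact huv (congrArg Prod.fst e)
      · intro p hp
        simp only [Finset.mem_insert, Finset.mem_singleton] at hp
        rcases hp with rfl | rfl
        · simp [hE0, hadj]
        · simp [hE0, hadj.symm]
    have h3 : 2 ≤ E0.card := by
      have : 1 < E0.card := by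
        rw [Finset.one_lt_card]
        exact ⟨(u, v), by simp [hE0, hadj], (v, u), by simp [hE0, hadj.symm],
          fun e => huv (congrArg Prod.fst e)⟩
      exact this
    omega
  · have h1 : T0.card = 0 := by
      rw [Finset.card_eq_zero, Finset.eq_empty_iff_forall_notMem]
      intro f hf
      rw [hT0, Finset.mem_filter] at hf
      exact hadj ((hF1 f hf.1).2 u hf.2.1 v hf.2.2 huv)
    have h2 : E.card ≤ E0.card := Finset.card_le_card Finset.sdiff_subset
    omega

end HubMain

section Final
open Classical
variable {V : Type} {G : SimpleGraph V}

theorem c3c5_of {a b c d e : V} (h : Cyc5 G a b c d e) {f : Finset V} (h3 : f.card = 3)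
    (ht : Tri G f) (hd : ∀ x ∈ f, x ∉ ({a, b, c, d, e} : Finset V)) : G.ContainsC3C5 := by
  obtain ⟨x, y, z, hxy, hxz, hyz, rfl⟩ := Finset.card_eq_three.1 h3
  have a1 := ht x (by simp) y (by simp) hxy
  have a2 := ht y (by simp) z (by simp) hyz
  have a3 := ht z (by simp) x (by simp) hxz.symm
  obtain ⟨g1, g2, g3, g4, g5, n1, n2, n3, n4, n5⟩ := h
  refine ⟨x, a, .cons a1 (.cons a2 (.cons a3 .nil)),
    .cons g1 (.cons g2 (.cons g3 (.cons g4 (.cons g5 .nil)))), ?_, rfl, ?_, rfl, ?_⟩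
  · rw [SimpleGraph.Walk.cons_isCycle_iff]
    constructor
    · simp [SimpleGraph.Walk.cons_isPath_iff, hxy, hxy.symm, hxz.symm, hyz]
    · simp [hxy, hxy.symm, hxz, hyz, hyz.symm, hxz.symm]
  · rw [SimpleGraph.Walk.cons_isCycle_iff]
    constructor
    · simp [SimpleGraph.Walk.cons_isPath_iff, g1.ne', g2.ne, g3.ne, g4.ne, g5.ne, n1.symm, n2.symm,
        n3, n4, n5]
    · simp [g1.ne, g1.ne', g2.ne, g3.ne, g4.ne, g5.ne, g5.ne', n1, n2, n1.symm, n2.symm,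
        n3, n4, n5]
  · intro w hw
    have := hd w (by simp at hw; simp; tauto)
    simp at this ⊢
    tauto

theorem p2_eq [Fintype V] : p2 G = 2 * G.edgeSet.ncard := by
  have h1 := G.dart_card_eq_twice_card_edges
  have h2 : G.edgeSet.ncard = G.edgeFinset.card := by
    rw [← SimpleGraph.coe_edgeFinset, Set.ncard_coe_finset]
  rw [h2, ← h1, p2, ← Finset.card_univ]
  symm
  apply Finset.card_bij (fun (d : G.Dart) _ => d.toProd)
  · intro d _; simp [d.adj]
  · intro d _ d' _ h; exact SimpleGraph.Dart.ext _ _ h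
  · intro p hp
    exact ⟨⟨p, (Finset.mem_filter.1 hp).2⟩, Finset.mem_univ _, rfl⟩

/-- a family of `k` faces which pairwise meet only in `s` -/
def Sun (F : Finset (Finset V)) (s : V) (k : ℕ) : Prop :=
  ∃ A ⊆ F, A.card = k ∧ (∀ f ∈ A, s ∈ f) ∧ ∀ f ∈ A, ∀ g ∈ A, f ≠ g → ∀ x ∈ f, x ∈ g → x = s

theorem Sun.hub {F : Finset (Finset V)} {s : V} (h : Sun F s 6)
    (hm : ∀ a b c d e, Cyc5 G a b c d e → ∀ f ∈ F, ∃ x ∈ f, x ∈ ({a, b, c, d, e} : Finset V)) :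
    Hub5 G s := by
  obtain ⟨A, hA, hc, -, hd⟩ := h
  intro a b c d e hcy
  by_contra hs
  have hm' := hm a b c d e hcy
  haveI : Nonempty V := ⟨s⟩
  choose! x hx1 hx2 using hm'
  have : A.card ≤ ({a, b, c, d, e} : Finset V).card := by
    apply Finset.card_le_card_of_injOn x
    · intro f hf; exact hx2 f (hA hf)
    · intro f hf g hg hfg
      by_contra hne
      have h1 := hd f hf g hg hne (x f) (hx1 f (hA hf)) (by rw [hfg]; exact hx1 g (hA hg))
      have h2 := hx2 f (hA hf)
      rw [h1] at h2
      simp at h2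
      exact hs h2
  have h5 : ({a, b, c, d, e} : Finset V).card ≤ 5 := Finset.card_le_five
  omega

theorem sun_step {F : Finset (Finset V)} {s : V} {k : ℕ} (h3 : ∀ f ∈ F, f.card = 3)
    (h2 : ∀ a b, a ≠ b → (F.filter fun f => a ∈ f ∧ b ∈ f).card ≤ 2)
    (h : Sun F s k) (hk : 4 * k < (F.filter fun f => s ∈ f).card) : Sun F s (k + 1) := by
  obtain ⟨A, hA, hc, hs, hd⟩ := h
  set W := A.biUnion fun f => f.erase s with hW
  have hWc : W.card ≤ A.card * 2 := by
    apply Finset.card_biUnion_le_card_mul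
    intro f hf
    rw [Finset.card_erase_of_mem (hs f hf), h3 f (hA hf)]
  have hB : (W.biUnion fun w => F.filter fun f => s ∈ f ∧ w ∈ f).card ≤ W.card * 2 := by
    apply Finset.card_biUnion_le_card_mul
    intro w hw
    rw [hW, Finset.mem_biUnion] at hw
    obtain ⟨f, -, hf⟩ := hw
    exact h2 s w (Finset.ne_of_mem_erase hf).symm
  obtain ⟨f, hf, hfB⟩ := Finset.exists_mem_notMem_of_card_lt_card
    (lt_of_le_of_lt hB (by omega : W.card * 2 < (F.filter fun f => s ∈ f).card))
  rw [Finset.mem_filter] at hf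
  have key : ∀ x ∈ f, x ∉ W := by
    intro x hx hxW
    apply hfB
    rw [Finset.mem_biUnion]
    exact ⟨x, hxW, by simp [hf, hx]⟩
  have key2 : ∀ g ∈ A, ∀ x ∈ f, x ∈ g → x = s := by
    intro g hg x hx hxg
    by_contra hxs
    exact key x hx (Finset.mem_biUnion.2 ⟨g, hg, Finset.mem_erase.2 ⟨hxs, hxg⟩⟩)
  have hfA : f ∉ A := by
    intro hfA
    obtain ⟨x, hx, hxs⟩ := Finset.exists_mem_ne (by rw [h3 f hf.1]; norm_num : 1 < f.card) s
    exact hxs (key2 f hfA x hx hx)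
  refine ⟨insert f A, ?_, by rw [Finset.card_insert_of_notMem hfA, hc], ?_, ?_⟩
  · intro g hg
    rcases Finset.mem_insert.1 hg with rfl | hg
    · exact hf.1
    · exact hA hg
  · intro g hg
    rcases Finset.mem_insert.1 hg with rfl | hg
    · exact hf.2
    · exact hs g hg
  · intro g hg g' hg' hne x hx hx'
    rcases Finset.mem_insert.1 hg with rfl | h1 <;> rcases Finset.mem_insert.1 hg' with rfl | h2
    · exact absurd rfl hne
    · exact key2 g' h2 x hx hx'
    · exact key2 g h1 x hx' hx
    · exact hd g h1 g' h2 hne x hx hx'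

theorem sun_of {F : Finset (Finset V)} {s : V} (h3 : ∀ f ∈ F, f.card = 3)
    (h2 : ∀ a b, a ≠ b → (F.filter fun f => a ∈ f ∧ b ∈ f).card ≤ 2)
    (hk : 20 < (F.filter fun f => s ∈ f).card) : ∀ k ≤ 6, Sun F s k := by
  intro k
  induction k with
  | zero => intro _; exact ⟨∅, by simp, by simp, by simp, by simp⟩
  | succ k ih => intro hk6; exact sun_step h3 h2 (ih (by omega)) (by omega)

theorem star_le [Fintype V] {F : Finset (Finset V)} (s : V) (h3 : ∀ f ∈ F, f.card = 3)
    (h2 : ∀ a b, a ≠ b → (F.filter fun f => a ∈ f ∧ b ∈ f).card ≤ 2) :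
    (F.filter fun f => s ∈ f).card ≤ Fintype.card V := by
  set A := F.filter fun f => s ∈ f with hA
  have h := Finset.sum_card_bipartiteAbove_eq_sum_card_bipartiteBelow
    (s := (Finset.univ : Finset V).erase s) (t := A) (fun (w : V) (f : Finset V) => w ∈ f)
  have h1 : ∑ w ∈ (Finset.univ : Finset V).erase s,
      (A.filter fun f => w ∈ f).card ≤ ∑ w ∈ (Finset.univ : Finset V).erase s, 2 := by
    apply Finset.sum_le_sum
    intro w hw
    have := h2 s w (Finset.ne_of_mem_erase hw).symm
    rwa [hA, Finset.filter_filter]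
  have h4 : ∑ f ∈ A, (((Finset.univ : Finset V).erase s).filter fun w => w ∈ f).card
      = ∑ f ∈ A, 2 := by
    apply Finset.sum_congr rfl
    intro f hf
    rw [hA, Finset.mem_filter] at hf
    have : ((Finset.univ : Finset V).erase s).filter (fun w => w ∈ f) = f.erase s := by
      ext w; simp
    rw [this, Finset.card_erase_of_mem hf.2, h3 f hf.1]
  simp only [Finset.bipartiteAbove, Finset.bipartiteBelow] at h
  rw [h4] at h
  rw [h, Finset.sum_const, Finset.sum_const, smul_eq_mul, smul_eq_mul] at h1
  have := Finset.card_erase_le (s := (Finset.univ : Finset V)) (a := s)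
  rw [Finset.card_univ] at this
  omega

theorem final_bound [Fintype V] (hP : G.IsPlanar) (hn : 400 ≤ Fintype.card V)
    (he : 16 * Fintype.card V ≤ 3 * p2 G + 24) : G.ContainsC3C5 := by
  by_contra hno
  obtain ⟨F, hF1, hF2, hF3, -⟩ := faces hP (by omega : 4 ≤ Fintype.card V)
  rw [Finset.card_univ] at hF3
  have hm : ∀ a b c d e, Cyc5 G a b c d e → ∀ f ∈ F, ∃ x ∈ f, x ∈ ({a, b, c, d, e} : Finset V) := by
    intro a b c d e hcy f hf
    by_contra hcon
    push Not at hcon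
    exact hno (c3c5_of hcy (hF1 f hf).1 (hF1 f hf).2 hcon)
  have two : ∀ u v, Hub5 G u → Hub5 G v → u = v := by
    intro u v hu hv
    by_contra huv
    have := two_hubs hP huv hu hv (by omega)
    omega
  have h3 : ∀ f ∈ F, f.card = 3 := fun f hf => (hF1 f hf).1
  by_cases hcy : ∃ a b c d e, Cyc5 G a b c d e
  · obtain ⟨a, b, c, d, e, hcy⟩ := hcy
    set Q : Finset V := {a, b, c, d, e} with hQ
    have hQ5 : Q.card ≤ 5 := Finset.card_le_five
    have hsub : F ⊆ Q.biUnion fun s => F.filter fun f => s ∈ f := by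
      intro f hf
      obtain ⟨x, hx, hxQ⟩ := hm _ _ _ _ _ hcy f hf
      exact Finset.mem_biUnion.2 ⟨x, hxQ, Finset.mem_filter.2 ⟨hf, hx⟩⟩
    have h1 : F.card ≤ ∑ s ∈ Q, (F.filter fun f => s ∈ f).card :=
      (Finset.card_le_card hsub).trans Finset.card_biUnion_le
    have hs : ∃ s0, ∀ s, s ≠ s0 → (F.filter fun f => s ∈ f).card ≤ 20 := by
      by_cases h : ∃ s0, Hub5 G s0
      · obtain ⟨s0, h0⟩ := h
        refine ⟨s0, fun s hs => ?_⟩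
        by_contra hc
        exact hs (two _ _ ((sun_of h3 hF2 (by omega) 6 le_rfl).hub hm) h0)
      · refine ⟨a, fun s _ => ?_⟩
        by_contra hc
        exact h ⟨s, (sun_of h3 hF2 (by omega) 6 le_rfl).hub hm⟩
    obtain ⟨s0, hs0⟩ := hs
    have h2 : ∑ s ∈ Q, (F.filter fun f => s ∈ f).card ≤
        ∑ s ∈ Q, (20 + if s = s0 then Fintype.card V else 0) := by
      apply Finset.sum_le_sum
      intro s _
      split_ifs with hss
      · have := star_le s h3 hF2; omega
      · have := hs0 s hss; omega
    rw [Finset.sum_add_distrib, Finset.sum_const, smul_eq_mul, Finset.sum_ite_eq'] at h2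
    split_ifs at h2 <;> omega
  · obtain ⟨u, v, huv⟩ := Fintype.exists_pair_of_one_lt_card (by omega : 1 < Fintype.card V)
    exact huv (two u v (fun a b c d e h => absurd ⟨a, b, c, d, e, h⟩ hcy)
      (fun a b c d e h => absurd ⟨a, b, c, d, e, h⟩ hcy))

end Final

/-- For `n ≥ 295660`, every `n`-vertex planar graph with more than
`⌊(8n-13)/3⌋` edges contains vertex-disjoint `C₃` and `C₅`. -/
theorem stmt3 (n : ℕ) (hn : 295660 ≤ n) {V : Type} [Fintype V]
    (G : SimpleGraph V) (hcard : Fintype.card V = n)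
    (hplanar : G.IsPlanar)
    (he : (8 * n - 13) / 3 < G.edgeSet.ncard) :
    G.ContainsC3C5 := by
  apply final_bound hplanar (by omega)
  rw [p2_eq]
  omega
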